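/- arXiv:math/9805038 — 3 statements merged into one kernel-verified Lean document; each statement's English description precedes it below -/
import Mathlib

section
/- (Cauchy's Theorem for monogenic functions, spherical instance.) Let n ≥ 2, let U ⊆ ℝⁿ be open, let f : U → Cl_n(ℂ) be left monogenic and g : U → Cl_n(ℂ) be right monogenic, and suppose the closed ball of center c and radius r > 0 is contained in U. Then ∫_{x ∈ S(c,r)} g(x)·ι((x−c)/r)·f(x) dμ^{n−1}(x) = 0, where S(c,r) is the sphere of center c and radius r, μ^{n−1} is the (n−1)-dimensional Hausdorff measure on ℝⁿ restricted to S(c,r), and (x−c)/r is the outward pointing unit normal vector to S(c,r) at x. -/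
noncomputable section
open MeasureTheory
open scoped BigOperators ENNReal

/-- ℂⁿ with its Euclidean norm. -/
abbrev Cn (n : ℕ) := EuclideanSpace ℂ (Fin n)
/-- ℝⁿ with its Euclidean norm. -/
abbrev Rn (n : ℕ) := EuclideanSpace ℝ (Fin n)

/-- `s z = z₁² + ⋯ + zₙ²`. -/
def sC (n : ℕ) (z : Cn n) : ℂ := ∑ j, z j ^ 2

/-- The quadratic form `Q z = -(z₁² + ⋯ + zₙ²)` on ℂⁿ. -/
def Qf (n : ℕ) : QuadraticForm ℂ (Cn n) :=
  (QuadraticMap.weightedSumSquares ℂ (fun _ : Fin n => (-1 : ℂ))).comp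
    (WithLp.linearEquiv 2 ℂ (Fin n → ℂ)).toLinearMap

/-- The complex Clifford algebra `Cl_n(ℂ)`. -/
abbrev Cl (n : ℕ) := CliffordAlgebra (Qf n)

/-- The structure map `ι : ℂⁿ → Cl_n(ℂ)`. -/
def ιC (n : ℕ) : Cn n →ₗ[ℂ] Cl n := CliffordAlgebra.ι (Qf n)

/-- The `j`-th standard basis vector of ℂⁿ. -/
def eC (n : ℕ) (j : Fin n) : Cn n := EuclideanSpace.single j 1
/-- The `j`-th standard basis vector of ℝⁿ. -/
def eR (n : ℕ) (j : Fin n) : Rn n := EuclideanSpace.single j 1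

/-- The componentwise embedding ℝⁿ → ℂⁿ. -/
def jmap (n : ℕ) (x : Rn n) : Cn n := (WithLp.equiv 2 (Fin n → ℂ)).symm fun i => (x i : ℂ)

/-- The complex Cauchy kernel `G(z) = s(z)^{-n/2} • ι(z)` (for `n` even). -/
def Gc (n : ℕ) (z : Cn n) : Cl n := ((sC n z) ^ (n / 2))⁻¹ • ιC n z

/-- The Euclidean Cauchy kernel `G(x) = ι(x)/‖x‖ⁿ`, `x ∈ ℝⁿ ∖ {0} ⊆ ℂⁿ`. -/
def Gr (n : ℕ) (x : Rn n) : Cl n := (((‖x‖ ^ n : ℝ) : ℂ))⁻¹ • ιC n (jmap n x)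

/-- `f : ℝⁿ → Cl_n(ℂ)` is differentiable on `U` with coordinate partial derivatives
`Df x j = (∂f/∂x_j)(x)`, tested against all `ℂ`-linear functionals of the
(finite-dimensional) Clifford algebra. -/
def HasPartialDerivsOn (n : ℕ) (f : Rn n → Cl n) (Df : Rn n → Fin n → Cl n)
    (U : Set (Rn n)) : Prop :=
  ∀ φ : Cl n →ₗ[ℂ] ℂ, ∀ x ∈ U, DifferentiableAt ℝ (fun y => φ (f y)) x ∧
    ∀ j : Fin n, fderiv ℝ (fun y => φ (f y)) x (eR n j) = φ (Df x j)

/-- `f` is left monogenic on `U`: it is differentiable and `∑ⱼ ι(eⱼ) · ∂f/∂xⱼ = 0` on `U`. -/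
def IsLeftMonogenicOn (n : ℕ) (f : Rn n → Cl n) (U : Set (Rn n)) : Prop :=
  ∃ Df : Rn n → Fin n → Cl n, HasPartialDerivsOn n f Df U ∧
    ∀ x ∈ U, ∑ j, ιC n (eC n j) * Df x j = 0

/-- `f` is right monogenic on `U`: it is differentiable and `∑ⱼ (∂f/∂xⱼ) · ι(eⱼ) = 0` on `U`. -/
def IsRightMonogenicOn (n : ℕ) (f : Rn n → Cl n) (U : Set (Rn n)) : Prop :=
  ∃ Df : Rn n → Fin n → Cl n, HasPartialDerivsOn n f Df U ∧
    ∀ x ∈ U, ∑ j, Df x j * ιC n (eC n j) = 0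

/-- `F : ℂⁿ → Cl_n(ℂ)` is holomorphic on `Ω` with complex coordinate partial
derivatives `DF z j = (∂F/∂z_j)(z)`, tested against all `ℂ`-linear functionals. -/
def HasCPartialDerivsOn (n : ℕ) (F : Cn n → Cl n) (DF : Cn n → Fin n → Cl n)
    (Ω : Set (Cn n)) : Prop :=
  ∀ φ : Cl n →ₗ[ℂ] ℂ, ∀ z ∈ Ω, DifferentiableAt ℂ (fun w => φ (F w)) z ∧
    ∀ j : Fin n, fderiv ℂ (fun w => φ (F w)) z (eC n j) = φ (DF z j)

/-- `F : ℂⁿ → Cl_n(ℂ)` is holomorphic (ℂ-differentiable) on `Ω`. -/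
def IsHolomorphicOn (n : ℕ) (F : Cn n → Cl n) (Ω : Set (Cn n)) : Prop :=
  ∀ φ : Cl n →ₗ[ℂ] ℂ, ∀ z ∈ Ω, DifferentiableAt ℂ (fun w => φ (F w)) z

/-- `F` is complex left monogenic on `Ω`: holomorphic with `∑ⱼ ι(eⱼ) · ∂F/∂zⱼ = 0` on `Ω`. -/
def IsCLeftMonogenicOn (n : ℕ) (F : Cn n → Cl n) (Ω : Set (Cn n)) : Prop :=
  ∃ DF : Cn n → Fin n → Cl n, HasCPartialDerivsOn n F DF Ω ∧
    ∀ z ∈ Ω, ∑ j, ιC n (eC n j) * DF z j = 0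

/-- `F` is complex right monogenic on `Ω`: holomorphic with `∑ⱼ (∂F/∂zⱼ) · ι(eⱼ) = 0` on `Ω`. -/
def IsCRightMonogenicOn (n : ℕ) (F : Cn n → Cl n) (Ω : Set (Cn n)) : Prop :=
  ∃ DF : Cn n → Fin n → Cl n, HasCPartialDerivsOn n F DF Ω ∧
    ∀ z ∈ Ω, ∑ j, DF z j * ιC n (eC n j) = 0

/-- The surface measure of the sphere `S(c,r) ⊆ ℝⁿ`: the `(n-1)`-dimensional Hausdorff
measure restricted to the sphere. -/
def sphereMeasure (n : ℕ) (c : Rn n) (r : ℝ) : Measure (Rn n) :=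
  (μH[(n : ℝ) - 1]).restrict (Metric.sphere c r)

theorem ExteriorAlgebra.finite_of_field (K M : Type*) [Field K] [AddCommGroup M] [Module K M]
    [Module.Finite K M] : Module.Finite K (ExteriorAlgebra K M) := by
  have htop := (DirectSum.Decomposition.isInternal (fun i : ℕ ↦ ⋀[K]^i M)).submodule_iSup_eq_top
  have hbot : ∀ i, Module.finrank K M < i → ⋀[K]^i M = ⊥ := by
    intro i hi
    rw [← Submodule.finrank_eq_zero (R := K), exteriorPower.finrank_eq, Nat.choose_eq_zero_of_lt hi]
  have hfin : ⨆ i : Fin (Module.finrank K M + 1), ⋀[K]^(i : ℕ) M = ⊤ := by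
    rw [eq_top_iff, ← htop]
    refine iSup_le fun i ↦ ?_
    rcases lt_or_ge (Module.finrank K M) i with hi | hi
    · rw [hbot i hi]
      exact bot_le
    · exact le_iSup (fun i : Fin (Module.finrank K M + 1) ↦ ⋀[K]^(i : ℕ) M)
        ⟨i, Nat.lt_succ_of_le hi⟩
  refine Module.finite_def.2 ?_
  rw [← hfin]
  exact Submodule.fg_iSup _ fun i ↦ Module.Finite.iff_fg.1 inferInstance

theorem CliffordAlgebra.finite_of_field {K M : Type*} [Field K] [Invertible (2 : K)]
    [AddCommGroup M] [Module K M] [Module.Finite K M] (Q : QuadraticForm K M) :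
    Module.Finite K (CliffordAlgebra Q) :=
  have := ExteriorAlgebra.finite_of_field K M
  Module.Finite.equiv (CliffordAlgebra.equivExterior Q).symm

theorem hausdorffMeasure_sphere_lt_top {n : ℕ} (hn : n ≠ 0) (c : Rn n) {r : ℝ} (hr : 0 < r) :
    μH[(n : ℝ) - 1] (Metric.sphere c r) < ⊤ := by
  obtain ⟨m, rfl⟩ := Nat.exists_eq_succ_of_ne_zero hn
  have hdim : ((m.succ : ℕ) : ℝ) - 1 = (Fintype.card (Fin m) : ℝ) := by simp
  rw [hdim]
  set face : Fin (m + 1) → ℝ → (Fin m → ℝ) → Rn (m + 1) :=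
    fun i s y ↦ WithLp.toLp 2 (i.insertNth s y) with hface
  set P : Fin (m + 1) → ℝ → (Fin m → ℝ) → Rn (m + 1) :=
    fun i s y ↦ c + (r / ‖face i s y‖) • face i s y with hP
  set K : Set (Fin m → ℝ) := Set.Icc (-1) 1 with hK
  have hlip : ∀ i s, s ≠ 0 → ∃ C, LipschitzOnWith C (P i s) K := by
    intro i s hs
    have hne : ∀ y, face i s y ≠ 0 := fun y h ↦ hs (by
      have := congrArg (fun v : Rn (m + 1) ↦ v i) h
      simpa [hface] using this)
    have hsmooth : ContDiff ℝ 1 (face i s) := by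
      refine (PiLp.contDiff_toLp).comp (contDiff_pi.2 fun j ↦ ?_)
      rcases Fin.eq_self_or_eq_succAbove i j with rfl | ⟨k, rfl⟩
      · simpa using contDiff_const
      · simpa using contDiff_apply ℝ ℝ k
    have hPs : ContDiff ℝ 1 (P i s) :=
      contDiff_const.add ((contDiff_const.div (hsmooth.norm ℝ hne)
        fun y ↦ norm_ne_zero_iff.2 (hne y)).smul hsmooth)
    exact (hPs.locallyLipschitz.locallyLipschitzOn (s := K)).exists_lipschitzOnWith_of_compact
      isCompact_Icc
  have hmeas : ∀ i s, s ≠ 0 → μH[(Fintype.card (Fin m) : ℝ)] (P i s '' K) < ⊤ := by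
    intro i s hs
    obtain ⟨C, hC⟩ := hlip i s hs
    refine (hC.hausdorffMeasure_image_le (Nat.cast_nonneg _)).trans_lt ?_
    rw [hausdorffMeasure_pi_real]
    exact ENNReal.mul_lt_top (by simp) isCompact_Icc.measure_lt_top
  have hcover : Metric.sphere c r ⊆ ⋃ i, (P i 1 '' K ∪ P i (-1) '' K) := by
    intro x hx
    set u := x - c with hu
    have hur : ‖u‖ = r := by simpa [dist_eq_norm] using hx
    obtain ⟨i, hi⟩ := Finite.exists_max (fun i ↦ |u i|)
    have hpos : 0 < |u i| := by
      by_contra h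
      have h0 : u = 0 := by
        ext j
        simpa using abs_nonpos_iff.1 ((hi j).trans (not_lt.1 h))
      rw [h0, norm_zero] at hur
      exact hr.ne hur
    set y : Fin m → ℝ := fun k ↦ u (i.succAbove k) / |u i| with hy
    have hyK : y ∈ K := by
      refine ⟨fun k ↦ ?_, fun k ↦ ?_⟩
      · have := neg_le_of_abs_le (hi (i.succAbove k))
        simp only [hy, Pi.neg_apply, Pi.one_apply]
        rw [le_div_iff₀ hpos]
        linarith
      · have := le_of_abs_le (hi (i.succAbove k))
        simp only [hy, Pi.one_apply]
        rw [div_le_iff₀ hpos]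
        linarith
    have key : ∀ s, u i / |u i| = s → P i s y = x := by
      intro s hs
      have hf : face i s y = |u i|⁻¹ • u := by
        ext j
        rcases Fin.eq_self_or_eq_succAbove i j with rfl | ⟨k, rfl⟩
        · simp [hface, ← hs, div_eq_inv_mul]
        · simp [hface, hy, div_eq_inv_mul]
      simp only [hP, hf, norm_smul, norm_inv, Real.norm_eq_abs, abs_abs, hur, smul_smul]
      have : r / (|u i|⁻¹ * r) * |u i|⁻¹ = 1 := by field_simp
      rw [this, one_smul, hu, add_sub_cancel]
    refine Set.mem_iUnion.2 ⟨i, ?_⟩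
    rcases le_total 0 (u i) with h | h
    · refine Or.inl ⟨y, hyK, key 1 ?_⟩
      rw [abs_of_nonneg h] at hpos ⊢
      exact div_self hpos.ne'
    · refine Or.inr ⟨y, hyK, key (-1) ?_⟩
      rw [abs_of_nonpos h] at hpos ⊢
      rw [div_neg, div_self (by linarith : u i ≠ 0)]
  refine (measure_mono hcover).trans_lt ((measure_iUnion_le _).trans_lt ?_)
  rw [tsum_fintype]
  exact ENNReal.sum_lt_top.2 fun i _ ↦ measure_union_lt_top (hmeas i 1 one_ne_zero)
    (hmeas i (-1) (by norm_num))

theorem integral_divergence_eq_zero {n : ℕ} {V : Fin n → Rn n → ℂ}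
    (hV : ∀ j, Differentiable ℝ (V j)) {M : ℝ} (hM : ∀ j x, M ≤ ‖x‖ → V j x = 0)
    (hint : Integrable fun x ↦ ∑ j, fderiv ℝ (V j) x (eR n j)) :
    ∫ x, ∑ j, fderiv ℝ (V j) x (eR n j) = 0 := by
  rcases n with _ | m
  · simp
  wlog hM0 : 0 ≤ M generalizing M
  · exact this (M := 0) (fun j x h ↦ hM j x ((not_le.1 hM0).le.trans h)) le_rfl
  have hpres := PiLp.volume_preserving_toLp (Fin (m + 1))
  have hemb : MeasurableEmbedding (WithLp.toLp 2 : (Fin (m + 1) → ℝ) → Rn (m + 1)) :=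
    (MeasurableEquiv.toLp 2 (Fin (m + 1) → ℝ)).measurableEmbedding
  set L : (Fin (m + 1) → ℝ) →L[ℝ] Rn (m + 1) :=
    (PiLp.continuousLinearEquiv 2 ℝ (fun _ : Fin (m + 1) ↦ ℝ)).symm.toContinuousLinearMap with hL
  have hLapp : ∀ y, L y = WithLp.toLp 2 y := fun y ↦ rfl
  have hcoord : ∀ (y : Fin (m + 1) → ℝ) i, |y i| ≤ ‖L y‖ := fun y i ↦ by
    exact PiLp.norm_apply_le (L y) i
  have hbasis : ∀ i, L (Pi.single i 1) = eR (m + 1) i := fun i ↦ by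
    simp [hLapp, eR, EuclideanSpace.single]
  set D : Rn (m + 1) → ℂ := fun x ↦ ∑ j, fderiv ℝ (V j) x (eR (m + 1) j) with hD
  have hD0 : ∀ x, M < ‖x‖ → D x = 0 := by
    intro x hx
    refine Finset.sum_eq_zero fun j _ ↦ ?_
    have : V j =ᶠ[nhds x] fun _ ↦ 0 := by
      filter_upwards [(isOpen_lt continuous_const continuous_norm).mem_nhds hx] with z hz
      exact hM j z (le_of_lt hz)
    rw [this.fderiv_eq]
    simp
  set a : Fin (m + 1) → ℝ := fun _ ↦ -M with ha
  set b : Fin (m + 1) → ℝ := fun _ ↦ M with hb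
  have hle : a ≤ b := fun i ↦ by simp [ha, hb]; linarith
  have hderiv : ∀ j y, HasFDerivAt (fun y ↦ V j (L y)) ((fderiv ℝ (V j) (L y)).comp L) y :=
    fun j y ↦ (hV j (L y)).hasFDerivAt.comp y L.hasFDerivAt
  have hdiv := integral_divergence_of_hasFDerivAt_off_countable' a b hle
    (fun j y ↦ V j (L y)) (fun j y ↦ (fderiv ℝ (V j) (L y)).comp L) ∅ Set.countable_empty
    (fun j y _ ↦ (hderiv j y).continuousAt.continuousWithinAt) (fun y _ j ↦ hderiv j y)
    (by
      simp only [ContinuousLinearMap.comp_apply, hbasis]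
      exact ((hpres.integrable_comp_emb hemb).2 hint).integrableOn)
  simp only [ContinuousLinearMap.comp_apply, hbasis] at hdiv
  rw [← hpres.integral_comp hemb]
  rw [setIntegral_eq_integral_of_forall_compl_eq_zero] at hdiv
  · refine hdiv.trans (Finset.sum_eq_zero fun i _ ↦ ?_)
    have hz : ∀ s : ℝ, |s| = M → ∀ y : Fin m → ℝ, V i (L (i.insertNth s y)) = 0 := by
      intro s hs y
      refine hM i _ (le_trans ?_ (hcoord _ i))
      simp [hs]
    have h1 := hz (a i) (by simp [ha, abs_of_nonneg hM0])
    have h2 := hz (b i) (by simp [hb, abs_of_nonneg hM0])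
    simp [h1, h2]
  · intro y hy
    refine hD0 (L y) ?_
    by_contra hcon
    refine hy ⟨fun i ↦ ?_, fun i ↦ ?_⟩
    · exact neg_le_of_abs_le ((hcoord y i).trans (not_lt.1 hcon))
    · exact le_of_abs_le ((hcoord y i).trans (not_lt.1 hcon))

theorem exists_antideriv_eq_zero_of_le {k : ℝ → ℝ} (hk : Continuous k) {T : ℝ}
    (hk0 : ∀ t, T ≤ t → k t = 0) :
    ∃ p : ℝ → ℝ, (∀ t, HasDerivAt p (k t) t) ∧ ∀ t, T ≤ t → p t = 0 := by
  refine ⟨fun t ↦ ∫ s in T..t, k s, fun t ↦ intervalIntegral.integral_hasDerivAt_right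
    (hk.intervalIntegrable _ _) hk.aestronglyMeasurable.stronglyMeasurableAtFilter
    hk.continuousAt, fun t ht ↦ ?_⟩
  change ∫ s in T..t, k s = 0
  rw [intervalIntegral.integral_congr (g := fun _ ↦ 0)]
  · simp
  · intro s hs
    rw [Set.uIcc_of_le ht] at hs
    exact hk0 s hs.1

theorem integral_radial_smul_eq_zero {n : ℕ} {U : Set (Rn n)}
    {F : Fin n → Rn n → ℂ} (hF : ∀ j, ∀ x ∈ U, DifferentiableAt ℝ (F j) x)
    (hdiv : ∀ x ∈ U, ∑ j, fderiv ℝ (F j) x (eR n j) = 0)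
    {c : Rn n} {R : ℝ} (hR : 0 ≤ R) (hball : Metric.closedBall c R ⊆ U)
    {k : ℝ → ℝ} (hk : Continuous k) (hk0 : ∀ t, R ^ 2 ≤ t → k t = 0) :
    ∫ x, k (‖x - c‖ ^ 2) • ∑ j, (x j - c j) • F j x = 0 := by
  obtain ⟨p, hp, hp0⟩ := exists_antideriv_eq_zero_of_le hk hk0
  set q : Rn n → ℝ := fun x ↦ p (‖x - c‖ ^ 2) with hq
  have hqd : ∀ x, HasFDerivAt q (k (‖x - c‖ ^ 2) • (2 : ℝ) • innerSL ℝ (x - c)) x := by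
    intro x
    have h1 : HasFDerivAt (fun x : Rn n ↦ ‖x - c‖ ^ 2) ((2 : ℝ) • innerSL ℝ (x - c)) x := by
      have := ((hasFDerivAt_id x).sub_const c).norm_sq
      rw [two_smul] at this ⊢
      exact this
    exact (hp _).comp_hasFDerivAt x h1
  have hout : ∀ x, x ∉ Metric.closedBall c R → R ^ 2 ≤ ‖x - c‖ ^ 2 := by
    intro x hx
    rw [Metric.mem_closedBall, dist_eq_norm, not_le] at hx
    gcongr
  have hUV : ∀ x ∈ U, ∀ j, HasFDerivAt (fun x ↦ q x • F j x)
      (q x • fderiv ℝ (F j) x + (k (‖x - c‖ ^ 2) • (2 : ℝ) • innerSL ℝ (x - c)).smulRight (F j x))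
      x := fun x hx j ↦ (hqd x).smul (hF j x hx).hasFDerivAt
  have hVout : ∀ x, x ∉ Metric.closedBall c R → ∀ j,
      HasFDerivAt (fun x ↦ q x • F j x) (0 : Rn n →L[ℝ] ℂ) x := by
    intro x hx j
    refine (hasFDerivAt_const (0 : ℂ) x).congr_of_eventuallyEq ?_
    filter_upwards [Metric.isClosed_closedBall.isOpen_compl.mem_nhds hx] with z hz
    simp [hq, hp0 _ (hout z hz)]
  have hVd : ∀ j, Differentiable ℝ (fun x ↦ q x • F j x) := by
    intro j x
    by_cases hx : x ∈ Metric.closedBall c R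
    · exact (hUV x (hball hx) j).differentiableAt
    · exact (hVout x hx j).differentiableAt
  set W : Rn n → ℂ := fun x ↦ k (‖x - c‖ ^ 2) • ∑ j, (x j - c j) • F j x with hW
  have hdivV : ∀ x, ∑ j, fderiv ℝ (fun x ↦ q x • F j x) x (eR n j) = (2 : ℝ) • W x := by
    intro x
    by_cases hx : x ∈ Metric.closedBall c R
    · have hx' := hball hx
      have : ∀ j, fderiv ℝ (fun x ↦ q x • F j x) x (eR n j) = q x • fderiv ℝ (F j) x (eR n j)
          + (2 : ℝ) • k (‖x - c‖ ^ 2) • (x j - c j) • F j x := by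
        intro j
        rw [(hUV x hx' j).fderiv]
        simp [eR, EuclideanSpace.inner_single_right]
        ring
      simp only [this, Finset.sum_add_distrib, ← Finset.smul_sum, hdiv x hx', smul_zero, zero_add,
        hW]
    · simp only [fun j ↦ (hVout x hx j).fderiv, hW, hk0 _ (hout x hx)]
      simp
  have hWc : Continuous W := by
    rw [continuous_iff_continuousAt]
    intro x
    by_cases hx : x ∈ Metric.closedBall c R
    · have hFc : ∀ j, ContinuousAt (F j) x := fun j ↦ (hF j x (hball hx)).continuousAt
      refine ContinuousAt.smul (f := fun x ↦ k (‖x - c‖ ^ 2)) (by fun_prop)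
        (tendsto_finsetSum _ fun j _ ↦ ?_)
      exact ContinuousAt.smul (f := fun x : Rn n ↦ x j - c j) (by fun_prop) (hFc j)
    · refine (continuousAt_const (y := (0 : ℂ))).congr ?_
      filter_upwards [Metric.isClosed_closedBall.isOpen_compl.mem_nhds hx] with z hz
      simp [hW, hk0 _ (hout z hz)]
  have hWs : HasCompactSupport W := by
    refine HasCompactSupport.intro (isCompact_closedBall c R) fun x hx ↦ ?_
    simp [hW, hk0 _ (hout x hx)]
  have hmain := integral_divergence_eq_zero hVd (M := ‖c‖ + R) (by
      intro j x hx
      have h1 : R ≤ ‖x - c‖ := by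
        have := norm_sub_norm_le x c
        linarith
      have h2 : R ^ 2 ≤ ‖x - c‖ ^ 2 := by gcongr
      simp [hq, hp0 _ h2])
    (by
      simp only [hdivV]
      exact (hWc.integrable_of_hasCompactSupport hWs).smul (2 : ℝ))
  simp only [hdivV, integral_smul] at hmain
  simpa using hmain

theorem exists_isometryEquiv_of_norm_sub_eq {n : ℕ} {c y z : Rn n} (h : ‖y - c‖ = ‖z - c‖) :
    ∃ e : Rn n ≃ᵢ Rn n, e c = c ∧ e y = z := by
  refine ⟨(IsometryEquiv.subRight c).trans
    ((Submodule.reflection (ℝ ∙ (y - c - (z - c)))ᗮ).toIsometryEquiv.trans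
      (IsometryEquiv.addRight c)), ?_, ?_⟩
  · simp
  · simp only [IsometryEquiv.trans_apply, IsometryEquiv.subRight_apply,
      LinearIsometryEquiv.coe_toIsometryEquiv, IsometryEquiv.addRight_apply,
      Submodule.reflection_sub h, sub_add_cancel]

theorem measurePreserving_sphereMeasure {n : ℕ} {c : Rn n} (r : ℝ) {e : Rn n ≃ᵢ Rn n}
    (he : e c = c) : MeasurePreserving e (sphereMeasure n c r) (sphereMeasure n c r) := by
  have h := (e.measurePreserving_hausdorffMeasure ((n : ℝ) - 1)).restrict_preimage
    (Metric.isClosed_sphere (x := c) (ε := r)).measurableSet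
  have hs : e ⁻¹' Metric.sphere c r = Metric.sphere c r := by
    ext x
    rw [Set.mem_preimage, Metric.mem_sphere, Metric.mem_sphere]
    nth_rewrite 1 [← he]
    rw [e.dist_eq]
  rwa [hs] at h

theorem integral_eq_zero_of_radial {n : ℕ} (hn : 0 < n) {c : Rn n} {r R : ℝ} (hrR : r < R)
    {μ : Measure (Rn n)} [IsFiniteMeasure μ] (hμ : ∀ᵐ x ∂μ, x ∈ Metric.sphere c r)
    (hrot : ∀ e : Rn n ≃ᵢ Rn n, e c = c → MeasurePreserving e μ μ)
    {G : Rn n → ℂ} (hG : ContinuousOn G (Metric.closedBall c R)) (hGμ : Integrable G μ)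
    (hrad : ∀ k : ℝ → ℝ, Continuous k → (∀ t, R ^ 2 ≤ t → k t = 0) →
      ∫ x, k (‖x - c‖ ^ 2) • G x = 0) :
    ∫ x, G x ∂μ = 0 := by
  suffices h : ∀ η : ℝ, 0 < η → ‖∫ x, G x ∂μ‖ ≤ η * μ.real Set.univ by
    have hlim : Filter.Tendsto (fun η : ℝ ↦ η * μ.real Set.univ) (nhdsWithin 0 (Set.Ioi 0))
        (nhds 0) := by
      have : Continuous fun η : ℝ ↦ η * μ.real Set.univ := by fun_prop
      simpa using (this.tendsto 0).mono_left nhdsWithin_le_nhds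
    have := ge_of_tendsto hlim (by filter_upwards [self_mem_nhdsWithin] with η hη using h η hη)
    exact norm_le_zero_iff.1 this
  intro η hη
  obtain ⟨δ, hδ, hunif⟩ := Metric.uniformContinuousOn_iff.1
    ((isCompact_closedBall c R).uniformContinuousOn_of_continuous hG) η hη
  set ε := min δ (R - r) with hε
  have hε0 : 0 < ε := lt_min hδ (sub_pos.2 hrR)
  set κ : Rn n → ℝ := fun z ↦ max 0 (ε - ‖z‖) with hκ
  have hκc : Continuous κ := by fun_prop
  have hκ0 : ∀ z, 0 ≤ κ z := fun z ↦ le_max_left _ _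
  have hκz : ∀ z, ε ≤ ‖z‖ → κ z = 0 := fun z hz ↦ max_eq_left (by linarith)
  have hκb : ∀ z, ‖κ z‖ ≤ ε := fun z ↦ by
    rw [Real.norm_of_nonneg (hκ0 z)]
    exact max_le hε0.le (by linarith [norm_nonneg z])
  have hκs : HasCompactSupport κ := by
    refine HasCompactSupport.intro (isCompact_closedBall 0 ε) fun z hz ↦ hκz z ?_
    rw [mem_closedBall_zero_iff, not_le] at hz
    exact hz.le
  have hκi : Integrable κ := hκc.integrable_of_hasCompactSupport hκs
  set b := ∫ z, κ z with hb
  have hb0 : 0 < b := by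
    refine hκc.integral_pos_of_hasCompactSupport_nonneg_nonzero hκs hκ0 (x := 0) ?_
    simp [hκ, hε0.ne', hε0.le]
  set a : Rn n → ℝ := fun y ↦ ∫ x, κ (x - y) ∂μ with ha
  have hac : Continuous a := by
    refine continuous_of_dominated (bound := fun _ ↦ ε) (fun y ↦ ?_)
      (fun y ↦ .of_forall fun x ↦ hκb _) (integrable_const _) (.of_forall fun x ↦ by fun_prop)
    exact (hκc.comp (continuous_id.sub continuous_const)).aestronglyMeasurable
  have harad : ∀ y z, ‖y - c‖ = ‖z - c‖ → a y = a z := by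
    intro y z h
    obtain ⟨e, hec, rfl⟩ := exists_isometryEquiv_of_norm_sub_eq h
    simp only [ha]
    rw [← (hrot e hec).integral_comp e.toHomeomorph.measurableEmbedding
      (fun x ↦ κ (x - e y))]
    simp only [hκ, ← dist_eq_norm, e.dist_eq]
  have ha0 : ∀ y, R ≤ ‖y - c‖ → a y = 0 := by
    intro y hy
    refine integral_eq_zero_of_ae ?_
    filter_upwards [hμ] with x hx
    refine hκz _ ?_
    rw [Metric.mem_sphere, dist_eq_norm] at hx
    have := norm_sub_norm_le (y - c) (x - c)
    rw [sub_sub_sub_cancel_right, norm_sub_rev y x] at this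
    linarith [min_le_right δ (R - r)]
  have haG : ∫ y, a y • G y = 0 := by
    set v : Rn n := eR n ⟨0, hn⟩ with hv
    have hv1 : ‖v‖ = 1 := by simp [hv, eR]
    have hnorm : ∀ t : ℝ, ‖(c + √t • v) - c‖ = √t := fun t ↦ by
      rw [add_sub_cancel_left, norm_smul, hv1, mul_one, Real.norm_of_nonneg (Real.sqrt_nonneg t)]
    have := hrad (fun t ↦ a (c + √t • v)) (by fun_prop) fun t ht ↦ ha0 _ (by
      rw [hnorm]
      exact Real.le_sqrt_of_sq_le ht)
    rw [← this]
    congr 1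
    ext1 y
    congr 1
    apply harad
    rw [hnorm, Real.sqrt_sq (norm_nonneg _)]
  set G' : Rn n → ℂ := (Metric.closedBall c R).indicator G with hG'
  have hG'i : Integrable G' :=
    (integrable_indicator_iff Metric.isClosed_closedBall.measurableSet).2
      (hG.integrableOn_compact (isCompact_closedBall c R))
  have hprod : Integrable (fun p : Rn n × Rn n ↦ κ (p.1 - p.2) • G' p.2) (μ.prod volume) := by
    refine (hG'i.comp_snd μ).bdd_smul ε ?_ (.of_forall fun p ↦ hκb _)
    exact (hκc.comp (continuous_fst.sub continuous_snd)).aestronglyMeasurable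
  set J : Rn n → ℂ := fun x ↦ ∫ y, κ (x - y) • G' y with hJ
  have hJi : Integrable J μ := hprod.integral_prod_left
  have hJ0 : ∫ x, J x ∂μ = 0 := by
    rw [hJ, integral_integral_swap hprod, ← haG]
    congr 1
    ext1 y
    rw [integral_smul_const]
    by_cases hy : y ∈ Metric.closedBall c R
    · rw [hG', Set.indicator_of_mem hy]
    · rw [Metric.mem_closedBall, dist_eq_norm, not_le] at hy
      rw [ha0 y hy.le, zero_smul]
      change a y • G' y = 0
      rw [ha0 y hy.le, zero_smul]
  have hest : ∀ᵐ x ∂μ, ‖b • G x - J x‖ ≤ b * η := by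
    filter_upwards [hμ] with x hx
    have hκx : Integrable fun y ↦ κ (x - y) := hκi.comp_sub_left x
    have hbx : ∫ y, κ (x - y) = b := integral_sub_left_eq_self κ volume x
    have hGx : Integrable fun y ↦ κ (x - y) • G' y := by
      refine hG'i.bdd_smul ε ?_ (.of_forall fun p ↦ hκb _)
      exact (hκc.comp (continuous_const.sub continuous_id)).aestronglyMeasurable
    rw [← hbx, ← integral_smul_const, hJ, ← integral_sub (hκx.smul_const _) hGx,
      ← integral_mul_const]
    refine norm_integral_le_of_norm_le (hκx.mul_const η) (.of_forall fun y ↦ ?_)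
    rw [← smul_sub, norm_smul, Real.norm_of_nonneg (hκ0 _)]
    rcases le_or_gt ε ‖x - y‖ with h | h
    · simp [hκz _ h]
    · refine mul_le_mul_of_nonneg_left ?_ (hκ0 _)
      have hxc : dist x c = r := hx
      have hxy : dist x y < ε := by rwa [dist_eq_norm]
      have hy : y ∈ Metric.closedBall c R := by
        have := dist_triangle_left y c x
        rw [Metric.mem_closedBall]
        linarith [min_le_right δ (R - r)]
      rw [hG', Set.indicator_of_mem hy, ← dist_eq_norm]
      exact (hunif x (Metric.mem_closedBall.2 (hxc.trans_le hrR.le)) y hy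
        (hxy.trans_le (min_le_left _ _))).le
  have hfinal := norm_integral_le_of_norm_le_const hest
  have hsub : ∫ x, (b • G x - J x) ∂μ = (∫ x, b • G x ∂μ) - ∫ x, J x ∂μ :=
    integral_sub (hGμ.smul b) hJi
  rw [hsub, hJ0, sub_zero, integral_smul, norm_smul,
    Real.norm_of_nonneg hb0.le, mul_assoc] at hfinal
  exact le_of_mul_le_mul_left hfinal hb0

theorem HasPartialDerivsOn.fderiv_bilinear {n : ℕ} {f g : Rn n → Cl n}
    {Df Dg : Rn n → Fin n → Cl n} {U : Set (Rn n)} (hf : HasPartialDerivsOn n f Df U)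
    (hg : HasPartialDerivsOn n g Dg U) (B : Cl n →ₗ[ℂ] Cl n →ₗ[ℂ] ℂ) {x : Rn n} (hx : x ∈ U) :
    DifferentiableAt ℝ (fun y ↦ B (g y) (f y)) x ∧
      ∀ j, fderiv ℝ (fun y ↦ B (g y) (f y)) x (eR n j) = B (Dg x j) (f x) + B (g x) (Df x j) := by
  have : Invertible (2 : ℂ) := invertibleOfNonzero two_ne_zero
  have : Module.Finite ℂ (Cl n) := CliffordAlgebra.finite_of_field (Qf n)
  set b := Module.finBasis ℂ (Cl n) with hb
  have hB : ∀ u v, B u v = ∑ i, b.coord i u * B (b i) v := by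
    intro u v
    conv_lhs => rw [← b.sum_repr u]
    simp only [map_sum, map_smul, LinearMap.sum_apply, LinearMap.smul_apply, smul_eq_mul,
      Module.Basis.coord_apply]
  have hder : HasFDerivAt (fun y ↦ B (g y) (f y))
      (∑ i, (b.coord i (g x) • fderiv ℝ (fun y ↦ B (b i) (f y)) x
        + B (b i) (f x) • fderiv ℝ (fun y ↦ b.coord i (g y)) x)) x := by
    simp only [fun y ↦ hB (g y) (f y)]
    exact HasFDerivAt.fun_sum fun i _ ↦
      (hg (b.coord i) x hx).1.hasFDerivAt.mul (hf (B (b i)) x hx).1.hasFDerivAt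
  refine ⟨hder.differentiableAt, fun j ↦ ?_⟩
  rw [hder.fderiv, hB (Dg x j), hB (g x), ← Finset.sum_add_distrib]
  simp only [sum_apply, add_apply, smul_apply, smul_eq_mul]
  refine Finset.sum_congr rfl fun i _ ↦ ?_
  rw [(hg (b.coord i) x hx).2 j, (hf (B (b i)) x hx).2 j]
  ring

theorem ιC_jmap {n : ℕ} (x : Rn n) : ιC n (jmap n x) = ∑ j, (x j : ℂ) • ιC n (eC n j) := by
  simp only [← map_smul, ← map_sum]
  congr 1
  ext i
  simp [jmap, eC, Finset.sum_apply, Pi.single_apply]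

/-- **Cauchy's theorem, spherical instance.** If `f` is left monogenic and
`g` is right monogenic on an open `U ⊆ ℝⁿ` containing the closed ball `B̄(c,r)`, then
`∫_{S(c,r)} g(x)·ι((x-c)/r)·f(x) dμ^{n-1}(x) = 0` (tested against every `ℂ`-linear
functional `φ` of the finite-dimensional algebra `Cl_n(ℂ)`, the integrands moreover being
integrable). -/
theorem cauchy_theorem_sphere (n : ℕ) (hn : 2 ≤ n) (U : Set (Rn n)) (hU : IsOpen U)
    (f g : Rn n → Cl n)
    (hf : IsLeftMonogenicOn n f U) (hg : IsRightMonogenicOn n g U)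
    (c : Rn n) (r : ℝ) (hr : 0 < r) (hball : Metric.closedBall c r ⊆ U) :
    ∀ φ : Cl n →ₗ[ℂ] ℂ,
      Integrable (fun x : Rn n => φ (g x * ιC n (jmap n (r⁻¹ • (x - c))) * f x))
        (sphereMeasure n c r) ∧
      ∫ x : Rn n, φ (g x * ιC n (jmap n (r⁻¹ • (x - c))) * f x)
          ∂(sphereMeasure n c r) = 0 := by
  intro φ
  obtain ⟨Df, hDf, hf0⟩ := hf
  obtain ⟨Dg, hDg, hg0⟩ := hg
  set B : Fin n → Cl n →ₗ[ℂ] Cl n →ₗ[ℂ] ℂ := fun j ↦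
    ((LinearMap.mul ℂ (Cl n)).compr₂ φ).comp (LinearMap.mulRight ℂ (ιC n (eC n j))) with hB
  have hBapp : ∀ j u v, B j u v = φ (u * ιC n (eC n j) * v) := fun j u v ↦ rfl
  set F : Fin n → Rn n → ℂ := fun j x ↦ B j (g x) (f x) with hF
  have hFd : ∀ j, ∀ x ∈ U, DifferentiableAt ℝ (F j) x :=
    fun j x hx ↦ (hDf.fderiv_bilinear hDg (B j) hx).1
  have hdiv : ∀ x ∈ U, ∑ j, fderiv ℝ (F j) x (eR n j) = 0 := by
    intro x hx
    have hFj : ∀ j, fderiv ℝ (F j) x (eR n j) =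
        φ (Dg x j * ιC n (eC n j) * f x) + φ (g x * (ιC n (eC n j) * Df x j)) := fun j ↦ by
      rw [← mul_assoc]
      exact (hDf.fderiv_bilinear hDg (B j) hx).2 j
    rw [Finset.sum_congr rfl fun j _ ↦ hFj j, Finset.sum_add_distrib, ← map_sum, ← map_sum,
      ← Finset.sum_mul, ← Finset.mul_sum, hf0 x hx, hg0 x hx]
    simp
  set G : Rn n → ℂ := fun x ↦ ∑ j, (x j - c j) • F j x with hG
  have hint : ∀ x, φ (g x * ιC n (jmap n (r⁻¹ • (x - c))) * f x) = r⁻¹ • G x := by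
    intro x
    simp only [ιC_jmap, Finset.mul_sum, Finset.sum_mul, map_sum, hG, hF, hBapp, Finset.smul_sum]
    refine Finset.sum_congr rfl fun j _ ↦ ?_
    simp
    ring
  simp only [hint]
  have hGc : ContinuousOn G U := by
    refine continuousOn_finsetSum _ fun j _ ↦
      ContinuousOn.smul (f := fun x : Rn n ↦ x j - c j) (by fun_prop) fun x hx ↦
      (hFd j x hx).continuousAt.continuousWithinAt
  have hsph := hausdorffMeasure_sphere_lt_top (by omega : n ≠ 0) c hr
  have : IsFiniteMeasure (sphereMeasure n c r) := ⟨by simpa [sphereMeasure] using hsph⟩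
  have hGi : Integrable G (sphereMeasure n c r) :=
    (hGc.mono (Metric.sphere_subset_closedBall.trans hball)).integrableOn_of_subset_isCompact
      (isCompact_sphere c r) Metric.isClosed_sphere.measurableSet subset_rfl hsph.ne
  obtain ⟨δ, hδ, hδU⟩ := (isCompact_closedBall c r).exists_cthickening_subset_open hU hball
  have hballR : Metric.closedBall c (r + δ) ⊆ U := by
    rwa [cthickening_closedBall hδ.le hr.le, add_comm] at hδU
  refine ⟨hGi.smul r⁻¹, ?_⟩
  rw [integral_smul, integral_eq_zero_of_radial (μ := sphereMeasure n c r) (by omega)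
    (lt_add_of_pos_right r hδ) (ae_restrict_mem Metric.isClosed_sphere.measurableSet)
    (fun e he ↦ measurePreserving_sphereMeasure r he) (hGc.mono hballR) hGi
    (fun k hk hk0 ↦ integral_radial_smul_eq_zero hFd hdiv (by positivity) hballR hk hk0),
    smul_zero]
end
end

section
/- (Holomorphic continuation to the cell of harmonicity.) Let n ≥ 2 be even, let U ⊆ ℝⁿ be a bounded open connected set, and let f : U → Cl_n(ℂ) be left monogenic. Let j : ℝⁿ → ℂⁿ be the componentwise embedding, and let U† (the cell of harmonicity of U) be the connected component containing j(U) of the open set ℂⁿ ∖ ⋃_{x ∈ ∂U} N(j(x)), where ∂U is the topological frontier of U in ℝⁿ. Then there exists a unique holomorphic function F : U† → Cl_n(ℂ) with F(j(x)) = f(x) for all x ∈ U; moreover F is complex left monogenic on U†, i.e. Σ_{j=1}^n ι(e_j)·(∂F/∂z_j)(z) = 0 on U†. -/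
noncomputable section
open MeasureTheory
open scoped BigOperators ENNReal

/-- The cell of harmonicity `U†` of a bounded open connected `U ⊆ ℝⁿ` (pointed at
`x₀ ∈ U`): the connected component containing `j(U)` of the complement in ℂⁿ of the
union of the null cones `N(j(x))`, `x ∈ ∂U`. -/
def cellOfHarmonicity (n : ℕ) (U : Set (Rn n)) (x₀ : Rn n) : Set (Cn n) :=
  connectedComponentIn
    {z : Cn n | ∀ x ∈ frontier U, sC n (z - jmap n x) ≠ 0} (jmap n x₀)

section HolomorphicContinuation

open Filter Set Topology

section NullCone

variable {n : ℕ}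

/-- The componentwise embedding ℝⁿ → ℂⁿ as a continuous real-linear map. -/
def jmapL (n : ℕ) : Rn n →L[ℝ] Cn n :=
  LinearMap.toContinuousLinearMap
    { toFun := jmap n
      map_add' := fun x y => by ext i; simp [jmap]
      map_smul' := fun c x => by ext i; simp [jmap] }

@[simp] lemma jmapL_apply (x : Rn n) : jmapL n x = jmap n x := rfl

@[simp] lemma jmap_apply (x : Rn n) (i : Fin n) : jmap n x i = (x i : ℂ) := rfl

lemma jmap_eR (i : Fin n) : jmap n (eR n i) = eC n i := by
  ext k
  by_cases h : k = i <;> simp [eR, eC, h]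

lemma continuous_jmap : Continuous (jmap n) := (jmapL n).continuous

lemma jmap_sub (x y : Rn n) : jmap n (x - y) = jmap n x - jmap n y := (jmapL n).map_sub x y

/-- The componentwise real part of a complex vector. -/
def rePart (z : Cn n) : Rn n := WithLp.toLp 2 fun i => (z i).re

/-- The componentwise imaginary part of a complex vector. -/
def imPart (z : Cn n) : Rn n := WithLp.toLp 2 fun i => (z i).im

@[simp] lemma rePart_apply (z : Cn n) (i : Fin n) : rePart z i = (z i).re := rfl

@[simp] lemma imPart_apply (z : Cn n) (i : Fin n) : imPart z i = (z i).im := rfl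

@[simp] lemma rePart_jmap (x : Rn n) : rePart (jmap n x) = x := by ext i; simp

@[simp] lemma imPart_jmap (x : Rn n) : imPart (jmap n x) = 0 := by ext i; simp

lemma jmap_rePart_add_imPart (z : Cn n) :
    jmap n (rePart z) + Complex.I • jmap n (imPart z) = z := by
  ext i
  simp [mul_comm Complex.I, Complex.re_add_im]

lemma continuous_rePart : Continuous (rePart : Cn n → Rn n) := by
  unfold rePart; fun_prop

lemma continuous_imPart : Continuous (imPart : Cn n → Rn n) := by
  unfold imPart; fun_prop

lemma continuous_sC : Continuous (sC n) := by
  unfold sC; fun_prop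

lemma sC_jmap (x : Rn n) : sC n (jmap n x) = ((‖x‖ ^ 2 : ℝ) : ℂ) := by
  simp [sC, EuclideanSpace.norm_sq_eq]

lemma sC_sub_jmap (z : Cn n) (x : Rn n) :
    sC n (z - jmap n x) = ((‖rePart z - x‖ ^ 2 - ‖imPart z‖ ^ 2 : ℝ) : ℂ)
      + ((2 * inner ℝ (imPart z) (rePart z - x) : ℝ) : ℂ) * Complex.I := by
  have hr : ∀ i, (z - jmap n x) i ^ 2 = (((z i).re - x i : ℝ) ^ 2 - (z i).im ^ 2 : ℂ)
      + (2 * (((z i).re - x i : ℝ) * (z i).im : ℂ)) * Complex.I := by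
    intro i
    have h : (z - jmap n x) i = ((z i).re - x i : ℝ) + (z i).im * Complex.I := by
      apply Complex.ext <;> simp
    rw [h]
    ring_nf
    rw [Complex.I_sq]
    ring
  rw [sC, Finset.sum_congr rfl fun i _ => hr i]
  simp only [EuclideanSpace.norm_sq_eq, PiLp.inner_apply, PiLp.sub_apply, Real.norm_eq_abs,
    sq_abs, rePart_apply, imPart_apply, RCLike.inner_apply, conj_trivial]
  push_cast
  rw [Finset.sum_add_distrib, Finset.sum_sub_distrib, Finset.mul_sum, Finset.sum_mul]

lemma sC_sub_jmap_eq_zero_iff (z : Cn n) (x : Rn n) :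
    sC n (z - jmap n x) = 0 ↔
      ‖rePart z - x‖ = ‖imPart z‖ ∧ inner ℝ (imPart z) (rePart z - x) = 0 := by
  have h : ‖rePart z - x‖ ^ 2 - ‖imPart z‖ ^ 2 = 0 ↔ ‖rePart z - x‖ = ‖imPart z‖ := by
    rw [sub_eq_zero, sq_eq_sq₀ (norm_nonneg _) (norm_nonneg _)]
  rw [sC_sub_jmap, Complex.ext_iff, ← h]
  simp only [Complex.add_re, Complex.add_im, Complex.re_ofReal_mul, Complex.im_ofReal_mul,
    Complex.ofReal_re, Complex.ofReal_im, Complex.I_re, Complex.I_im, Complex.zero_re,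
    Complex.zero_im, mul_zero, mul_one, add_zero, zero_add, mul_eq_zero, two_ne_zero, false_or]

/-- The real points of the null cone with vertex `z`. -/
def realNull (z : Cn n) : Set (Rn n) := {x | sC n (z - jmap n x) = 0}

lemma mem_realNull {z : Cn n} {x : Rn n} : x ∈ realNull z ↔ sC n (z - jmap n x) = 0 := Iff.rfl

lemma continuous_sC_sub_jmap : Continuous fun p : Cn n × Rn n => sC n (p.1 - jmap n p.2) :=
  continuous_sC.comp (continuous_fst.sub (continuous_jmap.comp continuous_snd))

lemma isClosed_realNull (z : Cn n) : IsClosed (realNull z) :=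
  isClosed_singleton.preimage (continuous_sC_sub_jmap.comp (Continuous.prodMk_right z))

lemma realNull_subset_closedBall (z : Cn n) :
    realNull z ⊆ Metric.closedBall (rePart z) ‖imPart z‖ := by
  intro x hx
  rw [Metric.mem_closedBall, dist_comm, dist_eq_norm]
  exact ((sC_sub_jmap_eq_zero_iff z x).1 hx).1.le

lemma isCompact_realNull (z : Cn n) : IsCompact (realNull z) :=
  (isCompact_closedBall _ _).of_isClosed_subset (isClosed_realNull z) (realNull_subset_closedBall z)

lemma realNull_jmap (x : Rn n) : realNull (jmap n x) = {x} := by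
  ext y
  rw [mem_realNull, sC_sub_jmap_eq_zero_iff]
  simp only [rePart_jmap, imPart_jmap, norm_zero, norm_eq_zero, sub_eq_zero, inner_zero_left,
    and_true, Set.mem_singleton_iff]
  exact eq_comm

lemma eventually_disjoint_realNull {K : Set (Rn n)} (hK : IsCompact K) {z₀ : Cn n}
    (h : Disjoint K (realNull z₀)) : ∀ᶠ z in 𝓝 z₀, Disjoint K (realNull z) := by
  have := hK.eventually_forall_of_forall_eventually (x₀ := z₀)
    (P := fun z x => sC n (z - jmap n x) ≠ 0) fun x hx =>
      continuous_sC_sub_jmap.continuousAt.eventually_ne (Set.disjoint_left.1 h hx)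
  filter_upwards [this] with z hz
  exact Set.disjoint_left.2 hz

lemma eventually_realNull_subset {W : Set (Rn n)} (hW : IsOpen W) {z₀ : Cn n}
    (h : realNull z₀ ⊆ W) : ∀ᶠ z in 𝓝 z₀, realNull z ⊆ W := by
  set R := ‖rePart z₀‖ + ‖imPart z₀‖ + 1
  have hK : IsCompact (Metric.closedBall (0 : Rn n) R ∩ Wᶜ) :=
    (isCompact_closedBall _ _).inter_right hW.isClosed_compl
  have hd : Disjoint (Metric.closedBall (0 : Rn n) R ∩ Wᶜ) (realNull z₀) :=
    Set.disjoint_left.2 fun x hx hx' => hx.2 (h hx')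
  have hR : ∀ᶠ z in 𝓝 z₀, ‖rePart z‖ + ‖imPart z‖ < R :=
    (continuous_rePart.norm.add continuous_imPart.norm).continuousAt.eventually_lt
      continuousAt_const (by simp [R])
  filter_upwards [eventually_disjoint_realNull hK hd, hR] with z hz hzR x hx
  by_contra hxW
  refine Set.disjoint_left.1 hz ⟨?_, hxW⟩ hx
  have h1 := realNull_subset_closedBall z hx
  rw [Metric.mem_closedBall, dist_eq_norm] at h1
  rw [mem_closedBall_zero_iff]
  linarith [norm_le_norm_add_norm_sub' x (rePart z)]

/-- Lower hemicontinuity of `z ↦ realNull z`. -/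
lemma eventually_realNull_inter_nonempty (hn : 2 ≤ n) {W : Set (Rn n)} (hW : IsOpen W) {z₀ : Cn n}
    (h : (realNull z₀ ∩ W).Nonempty) : ∀ᶠ z in 𝓝 z₀, (realNull z ∩ W).Nonempty := by
  obtain ⟨p, hp, hpW⟩ := h
  have hp' := (sC_sub_jmap_eq_zero_iff z₀ p).1 hp
  have key : ∀ (z : Cn n) (c : Rn n), ‖c‖ = ‖imPart z‖ → inner ℝ (imPart z) c = 0 →
      rePart z - c ∈ realNull z := by
    intro z c h1 h2
    rw [mem_realNull, sC_sub_jmap_eq_zero_iff]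
    simpa using ⟨h1, h2⟩
  by_cases hb : imPart z₀ = 0
  · have hpe : p = rePart z₀ := by
      have := hp'.1
      rw [hb, norm_zero, norm_eq_zero, sub_eq_zero] at this
      exact this.symm
    have horth : ∀ z : Cn n, ∃ c : Rn n, ‖c‖ = ‖imPart z‖ ∧ inner ℝ (imPart z) c = 0 := by
      intro z
      have hlt : 0 < Module.finrank ℝ (ℝ ∙ imPart z)ᗮ := by
        have h1 := (ℝ ∙ imPart z).finrank_add_finrank_orthogonal
        have h2 := finrank_span_le_card (R := ℝ) ({imPart z} : Set (Rn n))
        rw [finrank_euclideanSpace_fin] at h1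
        simp only [Set.toFinset_singleton, Finset.card_singleton] at h2
        omega
      have := Module.finrank_pos_iff.1 hlt
      obtain ⟨⟨v, hv⟩, hv0⟩ := exists_norm_eq (ℝ ∙ imPart z)ᗮ (norm_nonneg (imPart z))
      exact ⟨v, by simpa using hv0, Submodule.mem_orthogonal_singleton_iff_inner_right.1 hv⟩
    obtain ⟨ε, hε, hball⟩ := Metric.isOpen_iff.1 hW p hpW
    have h1 : ∀ᶠ z in 𝓝 z₀, ‖rePart z - p‖ + ‖imPart z‖ < ε :=
      ((continuous_rePart.sub continuous_const).norm.add
        continuous_imPart.norm).continuousAt.eventually_lt continuousAt_const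
        (by simpa [hb, hpe] using hε)
    filter_upwards [h1] with z hz
    obtain ⟨c, hc1, hc2⟩ := horth z
    refine ⟨rePart z - c, key z c hc1 hc2, hball ?_⟩
    rw [Metric.mem_ball, dist_eq_norm]
    calc ‖rePart z - c - p‖ = ‖(rePart z - p) - c‖ := by congr 1; abel
      _ ≤ ‖rePart z - p‖ + ‖c‖ := norm_sub_le _ _
      _ < ε := by rw [hc1]; exact hz
  · have hb' : ‖imPart z₀‖ ≠ 0 := norm_ne_zero_iff.2 hb
    set d : Cn n → Rn n := fun z =>
      (rePart z - p) - (inner ℝ (imPart z) (rePart z - p) / ‖imPart z‖ ^ 2) • imPart z with hd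
    have hd0 : d z₀ = rePart z₀ - p := by simp [hd, hp'.2]
    have hcr := (continuous_rePart (n := n)).continuousAt (x := z₀)
    have hci := (continuous_imPart (n := n)).continuousAt (x := z₀)
    have hdc : ContinuousAt d z₀ := by
      refine (hcr.sub continuousAt_const).sub (ContinuousAt.fun_smul ?_ hci)
      exact (hci.inner (𝕜 := ℝ) (hcr.sub continuousAt_const)).div (hci.norm.pow 2)
        (pow_ne_zero 2 hb')
    have hdn : ‖d z₀‖ ≠ 0 := by rw [hd0, hp'.1]; exact hb'
    set c : Cn n → Rn n := fun z => (‖imPart z‖ / ‖d z‖) • d z with hc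
    have hcc : ContinuousAt (fun z => rePart z - c z) z₀ :=
      hcr.sub ((hci.norm.div hdc.norm hdn).smul hdc)
    have hc0 : rePart z₀ - c z₀ ∈ W := by
      have : ‖imPart z₀‖ / ‖rePart z₀ - p‖ = 1 := by rw [hp'.1]; exact div_self hb'
      simpa [hc, hd0, this] using hpW
    filter_upwards [hcc.eventually_mem (hW.mem_nhds hc0), hdc.norm.eventually_ne hdn,
      hci.norm.eventually_ne hb'] with z hz1 hz2 hz3
    refine ⟨_, key z (c z) ?_ ?_, hz1⟩
    · rw [hc, norm_smul, norm_div, norm_norm, norm_norm, div_mul_cancel₀ _ hz2]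
    · simp only [hc, hd, inner_smul_right, inner_sub_right, real_inner_self_eq_norm_sq]
      field_simp
      ring

end NullCone

section Cell

variable {n : ℕ} {U : Set (Rn n)}

lemma isOpen_cellDomain (hUb : Bornology.IsBounded U) :
    IsOpen {z : Cn n | ∀ x ∈ frontier U, sC n (z - jmap n x) ≠ 0} := by
  have hK : IsCompact (frontier U) :=
    hUb.isCompact_closure.of_isClosed_subset isClosed_frontier frontier_subset_closure
  refine isOpen_iff_mem_nhds.2 fun z hz => ?_
  filter_upwards [eventually_disjoint_realNull hK (Set.disjoint_left.2 hz)] with w hw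
  exact Set.disjoint_left.1 hw

lemma isOpen_cellOfHarmonicity (hUb : Bornology.IsBounded U) (x₀ : Rn n) :
    IsOpen (cellOfHarmonicity n U x₀) :=
  (isOpen_cellDomain hUb).connectedComponentIn

lemma jmap_mem_cellDomain (hUo : IsOpen U) {x : Rn n} (hx : x ∈ U) :
    jmap n x ∈ {z : Cn n | ∀ x ∈ frontier U, sC n (z - jmap n x) ≠ 0} := by
  intro y hy h0
  have : y ∈ realNull (jmap n x) := h0
  rw [realNull_jmap, Set.mem_singleton_iff] at this
  rw [hUo.frontier_eq, this] at hy
  exact hy.2 hx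

lemma jmap_mem_cellOfHarmonicity (hUo : IsOpen U) (hUc : IsConnected U) {x₀ x : Rn n}
    (hx₀ : x₀ ∈ U) (hx : x ∈ U) : jmap n x ∈ cellOfHarmonicity n U x₀ := by
  refine (hUc.isPreconnected.image _ continuous_jmap.continuousOn).subset_connectedComponentIn
    (Set.mem_image_of_mem _ hx₀) ?_ (Set.mem_image_of_mem _ hx)
  rintro _ ⟨y, hy, rfl⟩
  exact jmap_mem_cellDomain hUo hy

lemma realNull_subset_of_mem_cellOfHarmonicity (hn : 2 ≤ n) (hUo : IsOpen U) {x₀ : Rn n}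
    (hx₀ : x₀ ∈ U) {z : Cn n} (hz : z ∈ cellOfHarmonicity n U x₀) : realNull z ⊆ U := by
  set Ω := {z : Cn n | ∀ x ∈ frontier U, sC n (z - jmap n x) ≠ 0}
  have hA : IsOpen {z : Cn n | realNull z ⊆ U} :=
    isOpen_iff_mem_nhds.2 fun z hz => eventually_realNull_subset hUo hz
  have hB : IsOpen {z : Cn n | (realNull z ∩ (closure U)ᶜ).Nonempty} :=
    isOpen_iff_mem_nhds.2 fun z hz =>
      eventually_realNull_inter_nonempty hn isClosed_closure.isOpen_compl hz
  refine isPreconnected_connectedComponentIn.subset_left_of_subset_union hA hB ?_ ?_ ?_ hz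
  · refine Set.disjoint_left.2 ?_
    rintro w hw ⟨x, hx, hxU⟩
    exact hxU (subset_closure (hw hx))
  · intro w hw
    by_contra hcon
    simp only [Set.mem_union, Set.mem_ofPred_eq, not_or, Set.not_subset] at hcon
    obtain ⟨⟨x, hx, hxU⟩, hne⟩ := hcon
    refine connectedComponentIn_subset _ _ hw x ?_ hx
    rw [hUo.frontier_eq]
    refine ⟨?_, hxU⟩
    by_contra hxc
    exact hne ⟨x, hx, hxc⟩
  · refine ⟨jmap n x₀, mem_connectedComponentIn (jmap_mem_cellDomain hUo hx₀), ?_⟩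
    rw [Set.mem_ofPred_eq, realNull_jmap]
    simpa using hx₀

end Cell

section Kernel

variable {n : ℕ} {E : Type*} [NormedAddCommGroup E] [NormedSpace ℂ E]

lemma sC_eC (i : Fin n) : sC n (eC n i) = 1 := by
  simp [sC, eC, ite_pow]

lemma sum_smul_eC (w : Cn n) : ∑ i, w i • eC n i = w := by
  ext k
  simp [eC, Pi.single_apply]

lemma contDiff_sC {m : WithTop ℕ∞} : ContDiff ℂ m (sC n) := by
  unfold sC; fun_prop

lemma fderiv_sC_apply (w v : Cn n) : fderiv ℂ (sC n) w v = 2 * ∑ i, w i * v i := by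
  have h : HasFDerivAt (sC n)
      (∑ i, (2 * w i) • (EuclideanSpace.proj i : Cn n →L[ℂ] ℂ)) w := by
    refine HasFDerivAt.fun_sum fun i _ => ?_
    simpa using ((EuclideanSpace.proj i : Cn n →L[ℂ] ℂ).hasFDerivAt (x := w)).pow 2
  rw [h.fderiv, Finset.mul_sum]
  simp [mul_assoc]

/-- Left multiplication by the complex Cauchy kernel, for a Clifford action `γ` of `ℂⁿ` on `E`. -/
def cauchyOp (γ : Cn n →L[ℂ] E →L[ℂ] E) (w : Cn n) : E →L[ℂ] E := (sC n w ^ (n / 2))⁻¹ • γ w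

variable (γ : Cn n →L[ℂ] E →L[ℂ] E)

lemma contDiffAt_cauchyOp {m : WithTop ℕ∞} {w : Cn n} (hw : sC n w ≠ 0) :
    ContDiffAt ℂ m (cauchyOp γ) w :=
  ((contDiff_sC.contDiffAt.pow (n / 2)).inv (pow_ne_zero _ hw)).smul γ.contDiff.contDiffAt

lemma continuousAt_cauchyOp {w : Cn n} (hw : sC n w ≠ 0) : ContinuousAt (cauchyOp γ) w :=
  (contDiffAt_cauchyOp γ (m := 0) hw).continuousAt

lemma hasFDerivAt_cauchyOp {w : Cn n} (hw : sC n w ≠ 0) :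
    HasFDerivAt (cauchyOp γ) (fderiv ℂ (cauchyOp γ) w) w :=
  ((contDiffAt_cauchyOp γ (m := 1) hw).differentiableAt one_ne_zero).hasFDerivAt

lemma continuousAt_fderiv_cauchyOp {w : Cn n} (hw : sC n w ≠ 0) :
    ContinuousAt (fderiv ℂ (cauchyOp γ)) w :=
  ((contDiffAt_cauchyOp γ (m := 1) hw).fderiv_right (m := 0) (by simp)).continuousAt

lemma fderiv_cauchyOp_apply {w : Cn n} (hw : sC n w ≠ 0) (v : Cn n) :
    fderiv ℂ (cauchyOp γ) w v = (sC n w ^ (n / 2))⁻¹ • γ v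
      - ((n / 2 : ℕ) * sC n w ^ (n / 2 - 1) * (2 * ∑ i, w i * v i) / (sC n w ^ (n / 2)) ^ 2) •
        γ w := by
  have hs : HasFDerivAt (sC n) (fderiv ℂ (sC n) w) w :=
    (contDiff_sC.differentiable one_ne_zero w).hasFDerivAt
  have h1 := (hasDerivAt_inv (pow_ne_zero (n / 2) hw)).comp_hasFDerivAt w (hs.pow (n / 2))
  have h2 : HasFDerivAt (cauchyOp γ) _ w := h1.smul γ.hasFDerivAt
  rw [h2.fderiv]
  ext e
  simp only [Function.comp_apply, add_apply, smul_apply, ContinuousLinearMap.smulRight_apply,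
    fderiv_sC_apply, smul_eq_mul, nsmul_eq_mul, sub_eq_add_neg, ← neg_smul]
  congr 2
  ring

lemma fderiv_cauchyOp_eC {w : Cn n} (hw : sC n w ≠ 0) (l : Fin n) :
    fderiv ℂ (cauchyOp γ) w (eC n l) = (sC n w ^ (n / 2))⁻¹ • γ (eC n l)
      - (((n / 2 : ℕ) * sC n w ^ (n / 2 - 1) * 2 / (sC n w ^ (n / 2)) ^ 2) * w l) • γ w := by
  have h : ∑ i, w i * eC n l i = w l := by simp [eC]
  rw [fderiv_cauchyOp_apply γ hw, h]
  congr 2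
  ring

lemma cauchyOp_scalar_identity (hn : 2 ≤ n) (heven : Even n) {s : ℂ} (hs : s ≠ 0) :
    n * ((s ^ (n / 2))⁻¹ * (-1)) -
      (n / 2 : ℕ) * s ^ (n / 2 - 1) * 2 / (s ^ (n / 2)) ^ 2 * (-s) = 0 := by
  obtain ⟨m, rfl⟩ := heven
  obtain ⟨k, rfl⟩ : ∃ k, m = k + 1 := ⟨m - 1, by omega⟩
  have h : (k + 1 + (k + 1)) / 2 = k + 1 := by omega
  rw [h, Nat.add_sub_cancel]
  field_simp
  push_cast
  ring

variable {γ} (hγ : ∀ w, γ w * γ w = -(sC n w) • (1 : E →L[ℂ] E))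
include hγ

/-- The Cauchy kernel is left monogenic. -/
lemma sum_mul_fderiv_cauchyOp (hn : 2 ≤ n) (heven : Even n) {w : Cn n} (hw : sC n w ≠ 0) :
    ∑ l, γ (eC n l) * fderiv ℂ (cauchyOp γ) w (eC n l) = 0 := by
  have hsum : ∑ l, w l • γ (eC n l) = γ w := by
    simp_rw [← map_smul]
    rw [← map_sum, sum_smul_eC]
  simp_rw [fderiv_cauchyOp_eC γ hw, mul_sub, mul_smul_comm, hγ, sC_eC, mul_smul _ (w _)]
  rw [Finset.sum_sub_distrib, ← Finset.smul_sum, ← Finset.smul_sum]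
  simp_rw [← smul_mul_assoc]
  rw [← Finset.sum_mul, ← Finset.smul_sum, smul_mul_assoc, hsum, hγ, Finset.sum_const,
    Finset.card_univ, Fintype.card_fin, ← Nat.cast_smul_eq_nsmul ℂ]
  simp only [smul_smul, ← sub_smul]
  convert zero_smul ℂ (1 : E →L[ℂ] E) using 2
  rw [← cauchyOp_scalar_identity hn heven hw]
  ring

/-- The Cauchy kernel is right monogenic. -/
lemma sum_fderiv_cauchyOp_mul (hn : 2 ≤ n) (heven : Even n) {w : Cn n} (hw : sC n w ≠ 0) :
    ∑ l, fderiv ℂ (cauchyOp γ) w (eC n l) * γ (eC n l) = 0 := by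
  have hsum : ∑ l, w l • γ (eC n l) = γ w := by
    simp_rw [← map_smul]
    rw [← map_sum, sum_smul_eC]
  simp_rw [fderiv_cauchyOp_eC γ hw, sub_mul, smul_mul_assoc, hγ, sC_eC, mul_smul _ (w _)]
  rw [Finset.sum_sub_distrib, ← Finset.smul_sum, ← Finset.smul_sum]
  simp_rw [← mul_smul_comm]
  rw [← Finset.mul_sum, ← Finset.smul_sum, mul_smul_comm, hsum, hγ, Finset.sum_const,
    Finset.card_univ, Fintype.card_fin, ← Nat.cast_smul_eq_nsmul ℂ]
  simp only [smul_smul, ← sub_smul]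
  convert zero_smul ℂ (1 : E →L[ℂ] E) using 2
  rw [← cauchyOp_scalar_identity hn heven hw]
  ring

end Kernel

section Divergence

variable {E : Type*} [NormedAddCommGroup E] [NormedSpace ℝ E]

/-- The divergence of a differentiable compactly supported vector field integrates to zero as soon
as it is continuous. -/
lemma integral_divergence_eq_zero_s8 {n : ℕ} [CompleteSpace E] (v : Fin n → Rn n → E)
    (v' : Fin n → Rn n → Rn n →L[ℝ] E) (hv : ∀ i x, HasFDerivAt (v i) (v' i x) x)
    (hsupp : ∀ i, HasCompactSupport (v i)) (hcont : Continuous fun x => ∑ i, v' i x (eR n i)) :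
    ∫ x, ∑ i, v' i x (eR n i) = 0 := by
  rcases n with _ | n
  · simp
  obtain ⟨R, hR⟩ : ∃ R : ℝ, ∀ i x, R ≤ ‖x‖ → v i x = 0 := by
    have : ∀ i, ∃ R : ℝ, ∀ x, R ≤ ‖x‖ → v i x = 0 := by
      intro i
      obtain ⟨R, hR⟩ := (HasCompactSupport.isCompact (hsupp i)).isBounded.exists_norm_le
      refine ⟨R + 1, fun x hx => image_eq_zero_of_notMem_tsupport fun h => ?_⟩
      linarith [hR x h]
    choose R hR using this
    refine ⟨∑ i, |R i|, fun i x hx => hR i x (le_trans ?_ hx)⟩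
    exact (le_abs_self _).trans
      (Finset.single_le_sum (f := fun i => |R i|) (fun _ _ => abs_nonneg _) (Finset.mem_univ i))
  set r := max R 0 with hr
  set T : (Fin (n + 1) → ℝ) ≃L[ℝ] Rn (n + 1) :=
    (PiLp.continuousLinearEquiv 2 ℝ fun _ : Fin (n + 1) => ℝ).symm with hT
  have hTapp : ∀ x i, T x i = x i := fun _ _ => rfl
  have hface : ∀ i (x : Rn (n + 1)), (∃ k, r ≤ |x k|) → v i x = 0 := by
    rintro i x ⟨k, hk⟩
    exact hR i x ((le_max_left _ _).trans (hk.trans (PiLp.norm_apply_le x k)))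
  have hdiv := integral_divergence_of_hasFDerivAt_off_countable' (E := E)
    (fun _ : Fin (n + 1) => -(r + 1)) (fun _ => r + 1) (fun _ => by
      have : 0 ≤ r := le_max_right _ _
      linarith)
    (fun i x => v i (T x)) (fun i x => (v' i (T x)).comp (T : (Fin (n + 1) → ℝ) →L[ℝ] Rn (n + 1)))
    ∅ Set.countable_empty
    (fun i => (continuous_iff_continuousAt.2 fun x =>
      ((hv i (T x)).continuousAt.comp T.continuous.continuousAt)).continuousOn)
    (fun x _ i => (hv i (T x)).comp x T.hasFDerivAt)
    ((hcont.comp T.continuous).continuousOn.integrableOn_compact isCompact_Icc)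
  have hpre := (PiLp.volume_preserving_toLp (Fin (n + 1))).integral_comp
    (MeasurableEquiv.toLp 2 (Fin (n + 1) → ℝ)).measurableEmbedding
    (fun x => ∑ i, v' i x (eR (n + 1) i))
  rw [← hpre, ← setIntegral_eq_integral_of_forall_compl_eq_zero
    (s := Set.Icc (fun _ : Fin (n + 1) => -(r + 1)) (fun _ => r + 1))]
  · refine hdiv.trans (Finset.sum_eq_zero fun i _ => ?_)
    have hr0 : 0 ≤ r := le_max_right _ _
    rw [setIntegral_eq_zero_of_forall_eq_zero, setIntegral_eq_zero_of_forall_eq_zero, sub_zero]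
    · intro x _
      refine hface i _ ⟨i, ?_⟩
      rw [hTapp, Fin.insertNth_apply_same, abs_neg, abs_of_nonneg (by linarith)]
      linarith
    · intro x _
      refine hface i _ ⟨i, ?_⟩
      rw [hTapp, Fin.insertNth_apply_same, abs_of_nonneg (by linarith)]
      linarith
  · intro x hx
    refine Finset.sum_eq_zero fun i _ => ?_
    have hx' : ∃ k, r < |x k| := by
      by_contra hcon
      push Not at hcon
      refine hx ⟨fun k => ?_, fun k => ?_⟩
      · linarith [neg_abs_le (x k), hcon k]
      · linarith [le_abs_self (x k), hcon k]
    obtain ⟨k, hk⟩ := hx'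
    have hev : ∀ᶠ y : Rn (n + 1) in 𝓝 (WithLp.toLp 2 x), v i y = 0 := by
      have : ∀ᶠ y : Rn (n + 1) in 𝓝 (WithLp.toLp 2 x), r < |y k| :=
        (EuclideanSpace.proj (𝕜 := ℝ) k).continuous.abs.continuousAt.eventually_const_lt hk
      exact this.mono fun y hy => hface i y ⟨k, hy.le⟩
    have h0 : HasFDerivAt (v i) (0 : Rn (n + 1) →L[ℝ] E) (WithLp.toLp 2 x) :=
      (hasFDerivAt_const (0 : E) _).congr_of_eventuallyEq hev
    rw [(hv i _).unique h0]
    rfl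

end Divergence

section Identity

/-- A holomorphic function vanishing near `a`, on a convex domain, is zero. -/
lemma eqOn_zero_of_convex {V : Type*} [NormedAddCommGroup V] [NormedSpace ℂ V] {B : Set V}
    (hBo : IsOpen B) (hBc : Convex ℝ B) {g : V → ℂ} (hg : DifferentiableOn ℂ g B) {q : V}
    (hq : q ∈ B) (h0 : g =ᶠ[𝓝 q] 0) : EqOn g 0 B := by
  intro w hw
  set ℓ : ℂ → V := fun t => q + t • (w - q)
  have hℓ : Differentiable ℂ ℓ := by fun_prop
  have hS : IsOpen (ℓ ⁻¹' B) := hBo.preimage hℓ.continuous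
  have hSc : Convex ℝ (ℓ ⁻¹' B) := by
    intro s hs t ht a b ha hb hab
    have : ℓ (a • s + b • t) = a • ℓ s + b • ℓ t := by
      have h : (a : ℝ) • q + (b : ℝ) • q = q := by rw [← add_smul, hab, one_smul]
      simp only [ℓ, smul_add, add_smul, smul_assoc]
      rw [add_add_add_comm, h]
    rw [Set.mem_preimage, this]
    exact hBc hs ht ha hb hab
  have han : AnalyticOnNhd ℂ (g ∘ ℓ) (ℓ ⁻¹' B) :=
    (hg.comp hℓ.differentiableOn (mapsTo_preimage _ _)).analyticOnNhd hS
  have h0' : (g ∘ ℓ) =ᶠ[𝓝 0] 0 := by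
    have : Tendsto ℓ (𝓝 0) (𝓝 q) := by simpa [ℓ] using hℓ.continuous.tendsto 0
    exact this.eventually h0
  have := han.eqOn_zero_of_preconnected_of_eventuallyEq_zero hSc.isPreconnected (z₀ := 0)
    (by simpa [ℓ] using hq) h0' (x := 1) (by simpa [ℓ] using hw)
  simpa [ℓ] using this

lemma eqOn_zero_of_isPreconnected {V : Type*} [NormedAddCommGroup V] [NormedSpace ℂ V] {Ω : Set V}
    (hΩ : IsOpen Ω) (hΩc : IsPreconnected Ω) {g : V → ℂ} (hg : DifferentiableOn ℂ g Ω) {q : V}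
    (hq : q ∈ Ω) (h0 : g =ᶠ[𝓝 q] 0) : EqOn g 0 Ω := by
  set Z : Set V := {z | g =ᶠ[𝓝 z] 0} with hZ
  have hZo : IsOpen Z := isOpen_setOfPred_eventually_nhds
  have hsub : Ω ⊆ Z := by
    refine hΩc.subset_of_closure_inter_subset hZo ⟨q, hq, h0⟩ ?_
    rintro p ⟨hpc, hpΩ⟩
    obtain ⟨r, hr, hball⟩ := Metric.isOpen_iff.1 hΩ p hpΩ
    obtain ⟨q', hq'Z, hq'⟩ := Metric.mem_closure_iff.1 hpc r hr
    have := eqOn_zero_of_convex Metric.isOpen_ball (convex_ball p r) (hg.mono hball)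
      (by rwa [Metric.mem_ball, dist_comm]) hq'Z
    exact this.eventuallyEq_of_mem (Metric.ball_mem_nhds p hr)
  exact fun z hz => (hsub hz).self_of_nhds

lemma eventuallyEq_zero_of_real {n : ℕ} {Ω : Set (Cn n)} (hΩ : IsOpen Ω) {g : Cn n → ℂ}
    (hg : DifferentiableOn ℂ g Ω) {U : Set (Rn n)} (hU : IsOpen U) {x₀ : Rn n} (hx₀ : x₀ ∈ U)
    (hx₀Ω : jmap n x₀ ∈ Ω) (h0 : ∀ x ∈ U, g (jmap n x) = 0) : g =ᶠ[𝓝 (jmap n x₀)] 0 := by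
  obtain ⟨ε, hε, hball⟩ := Metric.isOpen_iff.1 hΩ _ hx₀Ω
  have hc : Continuous fun z : Cn n => ‖jmap n (rePart z) - jmap n x₀‖ + 2 * ‖jmap n (imPart z)‖ :=
    ((continuous_jmap.comp continuous_rePart).sub continuous_const).norm.add
      (continuous_const.mul (continuous_jmap.comp continuous_imPart).norm)
  have hj0 : jmap n 0 = 0 := (jmapL n).map_zero
  have h1 : ∀ᶠ z in 𝓝 (jmap n x₀),
      ‖jmap n (rePart z) - jmap n x₀‖ + 2 * ‖jmap n (imPart z)‖ < ε :=
    hc.continuousAt.eventually_lt continuousAt_const (by simpa [hj0] using hε)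
  have h2 : ∀ᶠ z in 𝓝 (jmap n x₀), rePart z ∈ U :=
    continuous_rePart.continuousAt.eventually_mem (hU.mem_nhds (by simpa using hx₀))
  filter_upwards [h1, h2] with z hz1 hz2
  set ℓ : ℂ → Cn n := fun t => jmap n (rePart z) + t • jmap n (imPart z) with hℓ
  have hℓd : Differentiable ℂ ℓ := by fun_prop
  have hmaps : MapsTo ℓ (Metric.ball 0 2) Ω := by
    intro t ht
    rw [mem_ball_zero_iff] at ht
    refine hball ?_
    rw [Metric.mem_ball, dist_eq_norm]
    calc ‖ℓ t - jmap n x₀‖ = ‖(jmap n (rePart z) - jmap n x₀) + t • jmap n (imPart z)‖ := by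
          congr 1; simp only [hℓ]; abel
      _ ≤ ‖jmap n (rePart z) - jmap n x₀‖ + ‖t‖ * ‖jmap n (imPart z)‖ := by
          rw [← norm_smul]; exact norm_add_le _ _
      _ ≤ ‖jmap n (rePart z) - jmap n x₀‖ + 2 * ‖jmap n (imPart z)‖ := by gcongr
      _ < ε := hz1
  have han : AnalyticOnNhd ℂ (g ∘ ℓ) (Metric.ball 0 2) :=
    (hg.comp hℓd.differentiableOn hmaps).analyticOnNhd Metric.isOpen_ball
  have hfreq : ∃ᶠ t in 𝓝[≠] (0 : ℂ), (g ∘ ℓ) t = 0 := by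
    have hreal : ∀ᶠ t : ℝ in 𝓝 0, (g ∘ ℓ) (t : ℂ) = 0 := by
      have hcont : Continuous fun t : ℝ => rePart z + t • imPart z := by fun_prop
      have : ∀ᶠ t : ℝ in 𝓝 0, rePart z + t • imPart z ∈ U :=
        hcont.continuousAt.eventually_mem (hU.mem_nhds (by simpa using hz2))
      filter_upwards [this] with t ht
      rw [← h0 _ ht]
      simp only [Function.comp_apply, hℓ]
      congr 1
      ext i
      simp
    have htend : Tendsto (fun t : ℝ => (t : ℂ)) (𝓝[≠] 0) (𝓝[≠] 0) := by
      refine tendsto_nhdsWithin_iff.2 ⟨?_, ?_⟩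
      · exact (Complex.continuous_ofReal.tendsto' 0 0 rfl).mono_left nhdsWithin_le_nhds
      · filter_upwards [self_mem_nhdsWithin] with t ht
        simpa using ht
    exact htend.frequently (hreal.filter_mono nhdsWithin_le_nhds).frequently
  have := han.eqOn_zero_of_preconnected_of_frequently_eq_zero (convex_ball 0 2).isPreconnected
    (z₀ := 0) (by simp) hfreq (x := Complex.I) (by simp)
  simpa [hℓ, jmap_rePart_add_imPart] using this

end Identity

section KernelIntegral

variable {n : ℕ} {E : Type*} [NormedAddCommGroup E] [NormedSpace ℂ E]
  {H : Type*} [NormedAddCommGroup H] [NormedSpace ℂ H]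

/-- Convolution of the complex Cauchy kernel with a density `h` on `ℝⁿ`. -/
def kernelIntegral (γ : Cn n →L[ℂ] E →L[ℂ] E) (h : Rn n → E) (z : Cn n) : E :=
  ∫ x, cauchyOp γ (z - jmap n x) (h x)

lemma continuous_kernel_apply {K : Cn n → E →L[ℂ] H}
    (hK : ∀ w, sC n w ≠ 0 → ContinuousAt K w) {h : Rn n → E} (hh : Continuous h) {z : Cn n}
    (hd : Disjoint (tsupport h) (realNull z)) : Continuous fun x => K (z - jmap n x) (h x) := by
  refine continuous_iff_continuousAt.2 fun x => ?_
  by_cases hx : x ∈ tsupport h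
  · have h1 : ContinuousAt (fun y => K (z - jmap n y)) x :=
      (hK _ (Set.disjoint_left.1 hd hx)).comp (f := fun y => z - jmap n y)
        (continuous_const.sub continuous_jmap).continuousAt
    exact h1.clm_apply hh.continuousAt
  · refine (continuousAt_const (y := (0 : H))).congr ?_
    filter_upwards [notMem_tsupport_iff_eventuallyEq.1 hx] with y hy
    simp [hy]

lemma hasCompactSupport_kernel_apply (K : Cn n → E →L[ℂ] H) {h : Rn n → E}
    (hc : HasCompactSupport h) (z : Cn n) :
    HasCompactSupport fun x => K (z - jmap n x) (h x) :=
  hc.mono fun x hx hx' => hx (by simp [hx'])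

lemma integrable_kernel_apply {K : Cn n → E →L[ℂ] H}
    (hK : ∀ w, sC n w ≠ 0 → ContinuousAt K w) {h : Rn n → E} (hh : Continuous h)
    (hc : HasCompactSupport h) {z : Cn n} (hd : Disjoint (tsupport h) (realNull z)) :
    Integrable fun x => K (z - jmap n x) (h x) :=
  (continuous_kernel_apply hK hh hd).integrable_of_hasCompactSupport
    (hasCompactSupport_kernel_apply K hc z)

variable (γ : Cn n →L[ℂ] E →L[ℂ] E)

lemma continuousAt_flip_fderiv_cauchyOp {w : Cn n} (hw : sC n w ≠ 0) :
    ContinuousAt (fun w => (fderiv ℂ (cauchyOp γ) w).flip) w :=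
  (ContinuousLinearMap.flipₗᵢ ℂ (Cn n) E E).continuous.continuousAt.comp
    (continuousAt_fderiv_cauchyOp γ hw)

lemma hasFDerivAt_kernelIntegral {h : Rn n → E} (hh : Continuous h)
    (hc : HasCompactSupport h) {z : Cn n} (hd : Disjoint (tsupport h) (realNull z)) :
    HasFDerivAt (kernelIntegral γ h)
      (∫ x, (fderiv ℂ (cauchyOp γ) (z - jmap n x)).flip (h x)) z := by
  have hev := eventually_disjoint_realNull hc.isCompact hd
  obtain ⟨r, hr, hball⟩ := Metric.nhds_basis_closedBall.mem_iff.1 hev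
  have hcont : ContinuousOn
      (fun p : Cn n × Rn n => (fderiv ℂ (cauchyOp γ) (p.1 - jmap n p.2)).flip (h p.2))
      (Metric.closedBall z r ×ˢ tsupport h) := by
    rintro ⟨w, x⟩ ⟨hw, hx⟩
    have hne : sC n (w - jmap n x) ≠ 0 := Set.disjoint_left.1 (hball hw) hx
    have h1 : ContinuousAt
        (fun p : Cn n × Rn n => (fderiv ℂ (cauchyOp γ) (p.1 - jmap n p.2)).flip) (w, x) :=
      ContinuousAt.comp (g := fun w => (fderiv ℂ (cauchyOp γ) w).flip)
        (f := fun p : Cn n × Rn n => p.1 - jmap n p.2) (x := (w, x))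
        (continuousAt_flip_fderiv_cauchyOp γ hne)
        (continuous_fst.sub (continuous_jmap.comp continuous_snd)).continuousAt
    exact (h1.clm_apply (hh.comp continuous_snd).continuousAt).continuousWithinAt
  obtain ⟨C, hC⟩ := (((isCompact_closedBall z r).prod hc.isCompact).image_of_continuousOn
    hcont).isBounded.exists_norm_le
  refine hasFDerivAt_integral_of_dominated_of_fderiv_le
    (bound := (tsupport h).indicator fun _ => C)
    (F' := fun w x => (fderiv ℂ (cauchyOp γ) (w - jmap n x)).flip (h x))
    (Metric.closedBall_mem_nhds z hr) ?_ ?_ ?_ ?_ ?_ ?_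
  · filter_upwards [hev] with w hw
    exact (continuous_kernel_apply (fun _ => continuousAt_cauchyOp γ) hh hw).aestronglyMeasurable
  · exact integrable_kernel_apply (fun _ => continuousAt_cauchyOp γ) hh hc hd
  · exact (continuous_kernel_apply (K := fun w => (fderiv ℂ (cauchyOp γ) w).flip)
      (fun _ => continuousAt_flip_fderiv_cauchyOp γ) hh hd).aestronglyMeasurable
  · refine ae_of_all _ fun x w hw => ?_
    by_cases hx : x ∈ tsupport h
    · rw [indicator_of_mem hx]
      exact hC _ ⟨(w, x), ⟨hw, hx⟩, rfl⟩
    · simp [image_eq_zero_of_notMem_tsupport hx, indicator_of_notMem hx]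
  · exact (integrable_indicator_iff (isClosed_tsupport h).measurableSet).2
      (integrableOn_const hc.isCompact.measure_lt_top.ne)
  · refine ae_of_all _ fun x w hw => ?_
    by_cases hx : x ∈ tsupport h
    · have hne : sC n (w - jmap n x) ≠ 0 := Set.disjoint_left.1 (hball hw) hx
      have h1 : HasFDerivAt (fun w => cauchyOp γ (w - jmap n x))
          (fderiv ℂ (cauchyOp γ) (w - jmap n x)) w :=
        (hasFDerivAt_comp_sub (jmap n x)).2 (hasFDerivAt_cauchyOp γ hne)
      simpa using h1.clm_apply (hasFDerivAt_const (h x) w)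
    · simpa [image_eq_zero_of_notMem_tsupport hx] using hasFDerivAt_const (0 : E) w

lemma sum_clifford_fderiv_kernelIntegral [CompleteSpace E]
    (hγ : ∀ w, γ w * γ w = -(sC n w) • (1 : E →L[ℂ] E)) (hn : 2 ≤ n) (heven : Even n)
    {h : Rn n → E} (hh : Continuous h)
    (hc : HasCompactSupport h) {z : Cn n} (hd : Disjoint (tsupport h) (realNull z)) :
    ∑ l, γ (eC n l) (fderiv ℂ (kernelIntegral γ h) z (eC n l)) = 0 := by
  have hint : Integrable fun x => (fderiv ℂ (cauchyOp γ) (z - jmap n x)).flip (h x) :=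
    integrable_kernel_apply (K := fun w => (fderiv ℂ (cauchyOp γ) w).flip)
      (fun _ => continuousAt_flip_fderiv_cauchyOp γ) hh hc hd
  rw [(hasFDerivAt_kernelIntegral γ hh hc hd).fderiv]
  have h1 : ∀ l, γ (eC n l) ((∫ x, (fderiv ℂ (cauchyOp γ) (z - jmap n x)).flip (h x)) (eC n l)) =
      ∫ x, (γ (eC n l) * fderiv ℂ (cauchyOp γ) (z - jmap n x) (eC n l)) (h x) := by
    intro l
    rw [ContinuousLinearMap.integral_apply hint, ← ContinuousLinearMap.integral_comp_comm]
    · rfl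
    · exact hint.apply_continuousLinearMap _
  have h2 : ∀ l, Integrable fun x =>
      (γ (eC n l) * fderiv ℂ (cauchyOp γ) (z - jmap n x) (eC n l)) (h x) := fun l =>
    (γ (eC n l)).integrable_comp (hint.apply_continuousLinearMap (eC n l))
  simp_rw [h1]
  rw [← integral_finsetSum _ fun l _ => h2 l]
  refine integral_eq_zero_of_ae (ae_of_all _ fun x => ?_)
  by_cases hx : x ∈ tsupport h
  · change ∑ l, (γ (eC n l) * fderiv ℂ (cauchyOp γ) (z - jmap n x) (eC n l)) (h x) = 0
    rw [← _root_.sum_apply, sum_mul_fderiv_cauchyOp hγ hn heven (Set.disjoint_left.1 hd hx)]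
    rfl
  · simp [image_eq_zero_of_notMem_tsupport hx]

end KernelIntegral

section Cutoff

variable {n : ℕ} {E : Type*} [NormedAddCommGroup E] [NormedSpace ℂ E]

/-- A `C¹` function compactly supported in `U` and equal to `c` near the real points of the null
cone at `z`. -/
structure IsCutoff (U : Set (Rn n)) (z : Cn n) (c : ℝ) (χ : Rn n → ℝ) : Prop where
  contDiff : ContDiff ℝ 1 χ
  hasCompactSupport : HasCompactSupport χ
  tsupport_subset : tsupport χ ⊆ U
  eventually_eq : ∀ x ∈ realNull z, ∀ᶠ y in 𝓝 x, χ y = c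

lemma exists_isCutoff {U : Set (Rn n)} (hU : IsOpen U) {z : Cn n} (hz : realNull z ⊆ U) :
    ∃ χ, IsCutoff U z 1 χ := by
  obtain ⟨K, hK, hzK, hKU⟩ := exists_compact_between (isCompact_realNull z) hU hz
  obtain ⟨χ, h1, h0, -⟩ := exists_contMDiffMap_one_nhds_of_subset_interior (n := 1)
    (modelWithCornersSelf ℝ (Rn n)) (isClosed_realNull z) hzK
  have hsub : tsupport χ ⊆ K := closure_minimal (fun x hx => by
    by_contra hxK
    exact hx (h0 x hxK)) hK.isClosed
  exact ⟨χ, χ.contMDiff.contDiff, hK.of_isClosed_subset (isClosed_tsupport _) hsub,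
    hsub.trans hKU, fun x hx => eventually_nhdsSet_iff_forall.1 h1 x hx⟩

lemma IsCutoff.eventually {U : Set (Rn n)} {z : Cn n} {c : ℝ} {χ : Rn n → ℝ}
    (h : IsCutoff U z c χ) : ∀ᶠ w in 𝓝 z, IsCutoff U w c χ := by
  filter_upwards [eventually_realNull_subset
    (isOpen_setOfPred_eventually_nhds (p := fun y => χ y = c)) h.eventually_eq] with w hw
  exact ⟨h.1, h.2, h.3, hw⟩

lemma IsCutoff.sub {U : Set (Rn n)} {z : Cn n} {c d : ℝ} {χ ψ : Rn n → ℝ}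
    (h : IsCutoff U z c χ) (h' : IsCutoff U z d ψ) : IsCutoff U z (c - d) (χ - ψ) where
  contDiff := h.contDiff.sub h'.contDiff
  hasCompactSupport := h.hasCompactSupport.sub h'.hasCompactSupport
  tsupport_subset := (tsupport_sub χ ψ).trans (union_subset h.tsupport_subset h'.tsupport_subset)
  eventually_eq x hx := by
    filter_upwards [h.eventually_eq x hx, h'.eventually_eq x hx] with y hχy hψy
    simp [hχy, hψy]

/-- The Dirac operator applied to the cutoff `χ`, acting on `f`. -/
def cutoffDensity (γ : Cn n →L[ℂ] E →L[ℂ] E) (f : Rn n → E) (χ : Rn n → ℝ) (x : Rn n) : E :=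
  ∑ j, fderiv ℝ χ x (eR n j) • γ (eC n j) (f x)

variable (γ : Cn n →L[ℂ] E →L[ℂ] E) {f : Rn n → E} {χ : Rn n → ℝ}

lemma cutoffDensity_eventually_eq_zero {x : Rn n} {c : ℝ} (h : ∀ᶠ y in 𝓝 x, χ y = c) :
    ∀ᶠ y in 𝓝 x, cutoffDensity γ f χ y = 0 := by
  filter_upwards [h.eventually_nhds] with y hy
  have : fderiv ℝ χ y = 0 := by
    rw [EventuallyEq.fderiv_eq (f := fun _ => c) hy]
    simp
  simp [cutoffDensity, this]

lemma tsupport_cutoffDensity_subset : tsupport (cutoffDensity γ f χ) ⊆ tsupport χ := by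
  intro x hx
  by_contra hxχ
  exact notMem_tsupport_iff_eventuallyEq.2
    (cutoffDensity_eventually_eq_zero γ (notMem_tsupport_iff_eventuallyEq.1 hxχ)) hx

lemma hasCompactSupport_cutoffDensity (h : HasCompactSupport χ) :
    HasCompactSupport (cutoffDensity γ f χ) :=
  h.isCompact.of_isClosed_subset (isClosed_tsupport _) (tsupport_cutoffDensity_subset γ)

lemma continuous_cutoffDensity {U : Set (Rn n)} (hU : IsOpen U) (hf : ContinuousOn f U)
    (hχ : ContDiff ℝ 1 χ) (hχU : tsupport χ ⊆ U) : Continuous (cutoffDensity γ f χ) := by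
  refine continuous_iff_continuousAt.2 fun x => ?_
  by_cases hx : x ∈ tsupport χ
  · have hfx : ContinuousAt f x := hf.continuousAt (hU.mem_nhds (hχU hx))
    have hd : Continuous (fderiv ℝ χ) := hχ.continuous_fderiv one_ne_zero
    refine tendsto_finsetSum _ fun j _ => ?_
    exact (hd.clm_apply continuous_const).continuousAt.smul
      ((γ (eC n j)).continuous.continuousAt.comp hfx)
  · refine (continuousAt_const (y := (0 : E))).congr ?_
    filter_upwards [cutoffDensity_eventually_eq_zero γ (f := f)
      (notMem_tsupport_iff_eventuallyEq.1 hx)] with y hy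
    exact hy.symm

lemma IsCutoff.disjoint_tsupport_cutoffDensity {U : Set (Rn n)} {z : Cn n} {c : ℝ}
    (h : IsCutoff U z c χ) : Disjoint (tsupport (cutoffDensity γ f χ)) (realNull z) :=
  Set.disjoint_right.2 fun x hx => notMem_tsupport_iff_eventuallyEq.2
    (cutoffDensity_eventually_eq_zero γ (h.eventually_eq x hx))

variable {γ} {U : Set (Rn n)} {f' : Rn n → Rn n →L[ℝ] E}

/-- Cauchy's theorem: the kernel integral of a monogenic function against a cutoff vanishing near
the real points of the null cone is zero. -/
lemma IsCutoff.kernelIntegral_eq_zero [CompleteSpace E]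
    (hγ : ∀ w, γ w * γ w = -(sC n w) • (1 : E →L[ℂ] E)) (hn : 2 ≤ n) (heven : Even n)
    (hU : IsOpen U) (hf : ∀ x ∈ U, HasFDerivAt f (f' x) x)
    (hD : ∀ x ∈ U, ∑ j, γ (eC n j) (f' x (eR n j)) = 0) {z : Cn n}
    (h : IsCutoff U z 0 χ) : kernelIntegral γ (cutoffDensity γ f χ) z = 0 := by
  have hfc : ContinuousOn f U := fun x hx => (hf x hx).continuousAt.continuousWithinAt
  have hdisj : ∀ x ∈ tsupport χ, sC n (z - jmap n x) ≠ 0 := fun x hx hx' =>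
    notMem_tsupport_iff_eventuallyEq.2 (h.eventually_eq x hx') hx
  set v : Fin n → Rn n → E := fun j x => cauchyOp γ (z - jmap n x) (γ (eC n j) (χ x • f x)) with hv
  have hout : ∀ x ∉ tsupport χ, ∀ j, ∀ᶠ y in 𝓝 x, v j y = 0 := fun x hx j => by
    filter_upwards [notMem_tsupport_iff_eventuallyEq.1 hx] with y hy
    simp [hv, hy]
  have hin : ∀ x ∈ tsupport χ, ∀ j, ∃ L : Rn n →L[ℝ] E, HasFDerivAt (v j) L x ∧
      L (eR n j) = -(fderiv ℂ (cauchyOp γ) (z - jmap n x) (eC n j) * γ (eC n j)) (χ x • f x) +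
        (cauchyOp γ (z - jmap n x) (χ x • γ (eC n j) (f' x (eR n j))) +
        cauchyOp γ (z - jmap n x) (fderiv ℝ χ x (eR n j) • γ (eC n j) (f x))) := by
    intro x hx j
    have h1 : HasFDerivAt (fun y => z - jmap n y) (-jmapL n) x := by
      simpa using ((jmapL n).hasFDerivAt (x := x)).const_sub z
    have h2 := ((hasFDerivAt_cauchyOp γ (hdisj x hx)).restrictScalars ℝ).comp x h1
    have h3 := ((ContinuousLinearMap.restrictScalarsL ℂ E E ℝ ℝ).hasFDerivAt).comp x h2
    have h4 := ((h.contDiff.differentiable one_ne_zero x).hasFDerivAt).smul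
      (hf x (h.tsupport_subset hx))
    have h5 := (((γ (eC n j)).restrictScalars ℝ).hasFDerivAt).comp x h4
    refine ⟨_, h3.clm_apply h5, ?_⟩
    simp [jmap_eR]
    abel
  have hdiff : ∀ j x, DifferentiableAt ℝ (v j) x := fun j x => by
    by_cases hx : x ∈ tsupport χ
    · obtain ⟨L, hL, -⟩ := hin x hx j
      exact hL.differentiableAt
    · exact ((hasFDerivAt_const (0 : E) x).congr_of_eventuallyEq (hout x hx j)).differentiableAt
  have hdiv : (fun x => ∑ j, fderiv ℝ (v j) x (eR n j)) =
      fun x => cauchyOp γ (z - jmap n x) (cutoffDensity γ f χ x) := by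
    funext x
    by_cases hx : x ∈ tsupport χ
    · have h1 : ∀ j, fderiv ℝ (v j) x (eR n j) = _ := fun j => by
        obtain ⟨L, hL, hL'⟩ := hin x hx j
        rw [hL.fderiv, hL']
      simp_rw [h1]
      rw [Finset.sum_add_distrib, Finset.sum_add_distrib, Finset.sum_neg_distrib,
        ← _root_.sum_apply, sum_fderiv_cauchyOp_mul hγ hn heven (hdisj x hx), ← map_sum,
        ← Finset.smul_sum, hD x (h.tsupport_subset hx), ← map_sum]
      simp [cutoffDensity]
    · have h1 : ∀ j, fderiv ℝ (v j) x = 0 := fun j =>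
        ((hasFDerivAt_const (0 : E) x).congr_of_eventuallyEq (hout x hx j)).fderiv
      rw [(cutoffDensity_eventually_eq_zero γ
        (notMem_tsupport_iff_eventuallyEq.1 hx)).self_of_nhds]
      simp [h1]
  rw [kernelIntegral, ← hdiv]
  refine integral_divergence_eq_zero_s8 v _ (fun j x => (hdiff j x).hasFDerivAt) (fun j => ?_) ?_
  · exact h.hasCompactSupport.mono fun x hx hx' => hx (by simp [hv, hx'])
  · rw [hdiv]
    exact continuous_kernel_apply (fun _ => continuousAt_cauchyOp γ)
      (continuous_cutoffDensity γ hU hfc h.contDiff h.tsupport_subset)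
      (h.disjoint_tsupport_cutoffDensity γ)

lemma cutoffDensity_sub {χ ψ : Rn n → ℝ} (hχ : ContDiff ℝ 1 χ) (hψ : ContDiff ℝ 1 ψ) (x : Rn n) :
    cutoffDensity γ f (χ - ψ) x = cutoffDensity γ f χ x - cutoffDensity γ f ψ x := by
  simp only [cutoffDensity]
  rw [fderiv_sub (hχ.differentiable one_ne_zero x) (hψ.differentiable one_ne_zero x)]
  simp [sub_smul]

/-- The kernel integral does not depend on the cutoff. -/
lemma IsCutoff.kernelIntegral_congr [CompleteSpace E]
    (hγ : ∀ w, γ w * γ w = -(sC n w) • (1 : E →L[ℂ] E)) (hn : 2 ≤ n) (heven : Even n)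
    (hU : IsOpen U) (hf : ∀ x ∈ U, HasFDerivAt f (f' x) x)
    (hD : ∀ x ∈ U, ∑ j, γ (eC n j) (f' x (eR n j)) = 0) {z : Cn n} {c : ℝ} {ψ : Rn n → ℝ}
    (h : IsCutoff U z c χ) (h' : IsCutoff U z c ψ) :
    kernelIntegral γ (cutoffDensity γ f χ) z = kernelIntegral γ (cutoffDensity γ f ψ) z := by
  have hfc : ContinuousOn f U := fun x hx => (hf x hx).continuousAt.continuousWithinAt
  have hint : ∀ {χ}, IsCutoff U z c χ →
      Integrable fun x => cauchyOp γ (z - jmap n x) (cutoffDensity γ f χ x) := fun h =>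
    integrable_kernel_apply (fun _ => continuousAt_cauchyOp γ)
      (continuous_cutoffDensity γ hU hfc h.contDiff h.tsupport_subset)
      (hasCompactSupport_cutoffDensity γ h.hasCompactSupport) (h.disjoint_tsupport_cutoffDensity γ)
  have h0 := (sub_self c ▸ h.sub h').kernelIntegral_eq_zero hγ hn heven hU hf hD
  rw [kernelIntegral] at h0
  simp_rw [cutoffDensity_sub h.contDiff h'.contDiff, map_sub] at h0
  rw [integral_sub (hint h) (hint h'), sub_eq_zero] at h0
  exact h0

end Cutoff

section Reproduction

/-- A radial bump on `ℝⁿ`, the profile of the kernel integral against radial cutoffs. -/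
def radialDensity {n : ℕ} (u : Rn n) : ℝ :=
  2 * deriv Real.smoothTransition (2 - ‖u‖ ^ 2) * ‖u‖ ^ 2 * (‖u‖ ^ n)⁻¹

lemma deriv_smoothTransition_of_neg {t : ℝ} (ht : t < 0) : deriv Real.smoothTransition t = 0 := by
  rw [EventuallyEq.deriv_eq (f := fun _ => (0 : ℝ)), deriv_const]
  filter_upwards [gt_mem_nhds ht] with s hs using Real.smoothTransition.zero_of_nonpos hs.le

lemma deriv_smoothTransition_of_one_lt {t : ℝ} (ht : 1 < t) :
    deriv Real.smoothTransition t = 0 := by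
  rw [EventuallyEq.deriv_eq (f := fun _ => (1 : ℝ)), deriv_const]
  filter_upwards [lt_mem_nhds ht] with s hs using Real.smoothTransition.one_of_one_le hs.le

lemma continuous_deriv_smoothTransition : Continuous (deriv Real.smoothTransition) :=
  (Real.smoothTransition.contDiff (n := 1)).continuous_deriv_one

lemma exists_deriv_smoothTransition_ne_zero :
    ∃ t ∈ Ioo (0 : ℝ) 1, deriv Real.smoothTransition t ≠ 0 := by
  obtain ⟨t, ht, h⟩ := exists_deriv_eq_slope Real.smoothTransition one_pos
    Real.smoothTransition.continuous.continuousOn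
    (Real.smoothTransition.contDiff (n := 1)).contDiffOn.differentiableOn_one
  exact ⟨t, ht, by simp [h]⟩

variable {n : ℕ}

lemma radialDensity_of_two_lt {u : Rn n} (hu : 2 < ‖u‖) : radialDensity u = 0 := by
  rw [radialDensity, deriv_smoothTransition_of_neg (by nlinarith)]
  simp

lemma hasCompactSupport_radialDensity : HasCompactSupport (radialDensity (n := n)) :=
  HasCompactSupport.intro (isCompact_closedBall 0 2) fun u hu =>
    radialDensity_of_two_lt (by simpa using hu)

lemma continuous_radialDensity : Continuous (radialDensity (n := n)) := by
  refine continuous_iff_continuousAt.2 fun u => ?_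
  by_cases hu : u = 0
  · subst hu
    refine (continuousAt_const (y := (0 : ℝ))).congr ?_
    have : ∀ᶠ v : Rn n in 𝓝 0, ‖v‖ < 1 :=
      continuous_norm.continuousAt.eventually_lt_const (by simp)
    filter_upwards [this] with v hv
    rw [radialDensity, deriv_smoothTransition_of_one_lt (by nlinarith [norm_nonneg v])]
    simp
  · have h1 : Continuous fun u : Rn n => 2 * deriv Real.smoothTransition (2 - ‖u‖ ^ 2) * ‖u‖ ^ 2 :=
      (continuous_const.mul (continuous_deriv_smoothTransition.comp
        (continuous_const.sub (continuous_norm.pow 2)))).mul (continuous_norm.pow 2)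
    exact h1.continuousAt.mul
      ((continuous_norm.pow n).continuousAt.inv₀ (pow_ne_zero _ (norm_ne_zero_iff.2 hu)))

lemma integral_radialDensity_pos (hn : 2 ≤ n) : 0 < ∫ u : Rn n, radialDensity u := by
  obtain ⟨t, ht, h⟩ := exists_deriv_smoothTransition_ne_zero
  have hs : 0 < Real.sqrt (2 - t) := Real.sqrt_pos.2 (by linarith [ht.2])
  have hnorm : ‖Real.sqrt (2 - t) • eR n ⟨0, by omega⟩‖ = Real.sqrt (2 - t) := by
    simp [norm_smul, eR, hs.le]
  refine continuous_radialDensity.integral_pos_of_hasCompactSupport_nonneg_nonzero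
    (x := Real.sqrt (2 - t) • eR n ⟨0, by omega⟩) hasCompactSupport_radialDensity
    (fun u => ?_) ?_
  · have := Real.smoothTransition.monotone.deriv_nonneg (x := 2 - ‖u‖ ^ 2)
    simp only [Pi.zero_apply, radialDensity]
    positivity
  · rw [radialDensity, hnorm, Real.sq_sqrt (by linarith [ht.2]), sub_sub_cancel]
    have : (2 - t) ≠ 0 := by linarith [ht.2]
    positivity

/-- A radial cutoff, equal to `1` on the ball of radius `ε` about `x`. -/
def radialCutoff (x : Rn n) (ε : ℝ) (y : Rn n) : ℝ :=
  Real.smoothTransition (2 - ‖y - x‖ ^ 2 / ε ^ 2)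

lemma isCutoff_radialCutoff {U : Set (Rn n)} {x : Rn n} {ε : ℝ} (hε : 0 < ε)
    (hU : Metric.closedBall x (2 * ε) ⊆ U) : IsCutoff U (jmap n x) 1 (radialCutoff x ε) := by
  have hsub : tsupport (radialCutoff x ε) ⊆ Metric.closedBall x (2 * ε) :=
    closure_minimal (fun y hy => by
      by_contra hyx
      refine hy (Real.smoothTransition.zero_of_nonpos ?_)
      rw [Metric.mem_closedBall, dist_eq_norm, not_le] at hyx
      rw [sub_nonpos, le_div_iff₀ (by positivity)]
      nlinarith) Metric.isClosed_closedBall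
  refine ⟨?_, (isCompact_closedBall x (2 * ε)).of_isClosed_subset (isClosed_tsupport _) hsub,
    hsub.trans hU, fun y hy => ?_⟩
  · exact Real.smoothTransition.contDiff.comp
      (contDiff_const.sub (((contDiff_id.sub contDiff_const).norm_sq ℝ).div_const _))
  · rw [realNull_jmap, mem_singleton_iff] at hy
    subst hy
    filter_upwards [Metric.ball_mem_nhds y hε] with v hv
    refine Real.smoothTransition.one_of_one_le ?_
    rw [Metric.mem_ball, dist_eq_norm] at hv
    have : ‖v - y‖ ^ 2 / ε ^ 2 ≤ 1 := by
      rw [div_le_one (by positivity)]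
      exact pow_le_pow_left₀ (norm_nonneg _) hv.le 2
    linarith

lemma fderiv_radialCutoff (x : Rn n) (ε : ℝ) (y : Rn n) (j : Fin n) :
    fderiv ℝ (radialCutoff x ε) y (eR n j) =
      -(2 * deriv Real.smoothTransition (2 - ‖y - x‖ ^ 2 / ε ^ 2) / ε ^ 2) * (y - x) j := by
  have h1 : HasFDerivAt (fun y => 2 - ‖y - x‖ ^ 2 / ε ^ 2) _ y :=
    ((((hasFDerivAt_id y).sub_const x).norm_sq).mul_const (ε ^ 2)⁻¹).const_sub 2
  have h2 := (((Real.smoothTransition.contDiff (n := 1)).differentiable one_ne_zero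
    (2 - ‖y - x‖ ^ 2 / ε ^ 2)).hasDerivAt).comp_hasFDerivAt y h1
  change fderiv ℝ (Real.smoothTransition ∘ fun y => 2 - ‖y - x‖ ^ 2 / ε ^ 2) y _ = _
  rw [h2.fderiv]
  have h3 : ∀ v : Rn n, inner ℝ v (EuclideanSpace.single j (1 : ℝ)) = v j := fun v => by
    simp [EuclideanSpace.inner_single_right]
  simp [eR, h3]
  ring

variable {E : Type*} [NormedAddCommGroup E] [NormedSpace ℂ E] {γ : Cn n →L[ℂ] E →L[ℂ] E}

lemma cauchyOp_cutoffDensity_radialCutoff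
    (hγ : ∀ w, γ w * γ w = -(sC n w) • (1 : E →L[ℂ] E)) (heven : Even n) (f : Rn n → E)
    (x : Rn n) {ε : ℝ} (hε : 0 < ε) (y : Rn n) :
    cauchyOp γ (jmap n x - jmap n y) (cutoffDensity γ f (radialCutoff x ε) y) =
      -(ε ^ n)⁻¹ • (radialDensity (ε⁻¹ • (y - x)) • f (x + ε • ε⁻¹ • (y - x))) := by
  have hsum : cutoffDensity γ f (radialCutoff x ε) y =
      (-(2 * deriv Real.smoothTransition (2 - ‖y - x‖ ^ 2 / ε ^ 2) / ε ^ 2)) •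
        γ (jmap n (y - x)) (f y) := by
    conv_rhs => rw [← sum_smul_eC (jmap n (y - x)), map_sum, _root_.sum_apply, Finset.smul_sum]
    refine Finset.sum_congr rfl fun j _ => ?_
    rw [fderiv_radialCutoff, mul_smul, map_smul, _root_.smul_apply, jmap_apply,
      Complex.coe_smul]
  have hpow : ((‖y - x‖ ^ 2 : ℝ) : ℂ) ^ (n / 2) = ((‖y - x‖ ^ n : ℝ) : ℂ) := by
    rw [← Complex.ofReal_pow, ← pow_mul, Nat.mul_div_cancel' heven.two_dvd]
  have hker : cauchyOp γ (jmap n x - jmap n y) =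
      -(((‖y - x‖ ^ n)⁻¹ : ℝ) : ℂ) • γ (jmap n (y - x)) := by
    rw [← neg_sub, ← jmap_sub, cauchyOp, map_neg]
    have : sC n (-jmap n (y - x)) = sC n (jmap n (y - x)) := by
      simp only [sC, PiLp.neg_apply, neg_sq]
    rw [this, sC_jmap, hpow]
    simp
  have hsq : γ (jmap n (y - x)) (γ (jmap n (y - x)) (f y)) =
      (-‖y - x‖ ^ 2 : ℝ) • f y := by
    have := congrArg (fun L : E →L[ℂ] E => L (f y)) (hγ (jmap n (y - x)))
    rw [sC_jmap] at this
    rw [← Complex.coe_smul]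
    simpa using this
  have hγr : ∀ (c : ℝ) (e : E), γ (jmap n (y - x)) (c • e) = c • γ (jmap n (y - x)) e :=
    fun c e => by rw [← Complex.coe_smul, map_smul, Complex.coe_smul]
  rw [hker, hsum, _root_.smul_apply, hγr, hsq, smul_inv_smul₀ hε.ne', add_sub_cancel,
    ← Complex.ofReal_neg, Complex.coe_smul, smul_smul, smul_smul, smul_smul, radialDensity,
    norm_smul, norm_inv, Real.norm_of_nonneg hε.le]
  congr 1
  have : (ε⁻¹ * ‖y - x‖) ^ 2 = ‖y - x‖ ^ 2 / ε ^ 2 := by field_simp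
  rw [this, mul_pow, mul_inv, inv_pow, inv_inv]
  field_simp

lemma kernelIntegral_radialCutoff
    (hγ : ∀ w, γ w * γ w = -(sC n w) • (1 : E →L[ℂ] E)) (heven : Even n) (f : Rn n → E)
    (x : Rn n) {ε : ℝ} (hε : 0 < ε) :
    kernelIntegral γ (cutoffDensity γ f (radialCutoff x ε)) (jmap n x) =
      -∫ u, radialDensity u • f (x + ε • u) := by
  rw [kernelIntegral]
  simp_rw [cauchyOp_cutoffDensity_radialCutoff hγ heven f x hε]
  rw [integral_smul, integral_sub_right_eq_self
    (fun v => radialDensity (ε⁻¹ • v) • f (x + ε • ε⁻¹ • v)) x,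
    Measure.integral_comp_inv_smul_of_nonneg volume
      (fun u => radialDensity u • f (x + ε • u)) hε.le,
    smul_smul, finrank_euclideanSpace, Fintype.card_fin, neg_mul,
    inv_mul_cancel₀ (pow_ne_zero _ hε.ne'), neg_one_smul]

/-- The kernel integral of a monogenic function reproduces it at real points, up to a constant. -/
lemma IsCutoff.kernelIntegral_jmap [CompleteSpace E]
    (hγ : ∀ w, γ w * γ w = -(sC n w) • (1 : E →L[ℂ] E)) (hn : 2 ≤ n) (heven : Even n)
    {U : Set (Rn n)} {f : Rn n → E} {f' : Rn n → Rn n →L[ℝ] E}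
    (hU : IsOpen U) (hf : ∀ x ∈ U, HasFDerivAt f (f' x) x)
    (hD : ∀ x ∈ U, ∑ j, γ (eC n j) (f' x (eR n j)) = 0) {x : Rn n} (hx : x ∈ U)
    {χ : Rn n → ℝ} (h : IsCutoff U (jmap n x) 1 χ) :
    kernelIntegral γ (cutoffDensity γ f χ) (jmap n x) =
      -((∫ u : Rn n, radialDensity u) • f x) := by
  have hF : Continuous fun y => χ y • f y := by
    refine continuous_iff_continuousAt.2 fun y => ?_
    by_cases hy : y ∈ tsupport χ
    · exact h.contDiff.continuous.continuousAt.smul (hf y (h.tsupport_subset hy)).continuousAt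
    · refine (continuousAt_const (y := (0 : E))).congr ?_
      filter_upwards [notMem_tsupport_iff_eventuallyEq.1 hy] with v hv
      simp [hv]
  set G : ℝ → E := fun ε => ∫ u in Metric.closedBall 0 2,
    radialDensity u • χ (x + ε • u) • f (x + ε • u) with hG
  have hGc : Continuous G := by
    refine continuous_parametric_integral_of_continuous ?_ (isCompact_closedBall _ _)
    exact (continuous_radialDensity.comp continuous_snd).smul
      (hF.comp (continuous_const.add (continuous_fst.smul continuous_snd)))
  have hset : ∀ g : Rn n → E, ∫ u in Metric.closedBall 0 2, radialDensity u • g u =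
      ∫ u, radialDensity u • g u := fun g =>
    setIntegral_eq_integral_of_forall_compl_eq_zero fun u hu => by
      rw [radialDensity_of_two_lt (by simpa using hu), zero_smul]
  have h1 := h.eventually_eq x (by simp [realNull_jmap])
  have hev : ∀ᶠ ε in 𝓝[>] (0 : ℝ),
      G ε = -kernelIntegral γ (cutoffDensity γ f χ) (jmap n x) := by
    obtain ⟨δ, hδ, hball⟩ := Metric.nhds_basis_closedBall.mem_iff.1
      (inter_mem (hU.mem_nhds hx) h1)
    filter_upwards [Ioo_mem_nhdsGT (half_pos hδ)] with ε hε
    have hsub : Metric.closedBall x (2 * ε) ⊆ Metric.closedBall x δ :=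
      Metric.closedBall_subset_closedBall (by linarith [hε.2])
    have hcut := isCutoff_radialCutoff hε.1
      (hsub.trans (hball.trans inter_subset_left))
    rw [h.kernelIntegral_congr hγ hn heven hU hf hD hcut,
      kernelIntegral_radialCutoff hγ heven f x hε.1, neg_neg, ← hset]
    refine setIntegral_congr_fun Metric.isClosed_closedBall.measurableSet fun u hu => ?_
    have hu2 : x + ε • u ∈ Metric.closedBall x (2 * ε) := by
      have := hε.1
      have hu' : ‖u‖ ≤ 2 := by simpa using hu
      simp only [Metric.mem_closedBall, dist_self_add_left, norm_smul, Real.norm_of_nonneg this.le]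
      nlinarith
    have : χ (x + ε • u) = 1 := (hball (hsub hu2)).2
    simp [this]
  have hlim := tendsto_nhds_unique ((hGc.tendsto 0).mono_left nhdsWithin_le_nhds)
    ((tendsto_congr' hev).2 tendsto_const_nhds)
  rw [← neg_eq_iff_eq_neg, ← hlim, hG]
  simp only [zero_smul, add_zero, h1.self_of_nhds, one_smul]
  rw [hset, integral_smul_const]

end Reproduction

section Continuation

variable {n : ℕ} {E : Type*} [NormedAddCommGroup E] [NormedSpace ℂ E] [CompleteSpace E]
  {γ : Cn n →L[ℂ] E →L[ℂ] E}

/-- A monogenic function extends to all points whose null cone meets `ℝⁿ` only inside `U`. -/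
lemma exists_complexMonogenic_extension
    (hγ : ∀ w, γ w * γ w = -(sC n w) • (1 : E →L[ℂ] E)) (hn : 2 ≤ n) (heven : Even n)
    {U : Set (Rn n)} {f : Rn n → E} {f' : Rn n → Rn n →L[ℝ] E}
    (hU : IsOpen U) (hf : ∀ x ∈ U, HasFDerivAt f (f' x) x)
    (hD : ∀ x ∈ U, ∑ j, γ (eC n j) (f' x (eR n j)) = 0) :
    ∃ F : Cn n → E, (∀ x ∈ U, F (jmap n x) = f x) ∧ ∀ z, realNull z ⊆ U →
      DifferentiableAt ℂ F z ∧ ∑ l, γ (eC n l) (fderiv ℂ F z (eC n l)) = 0 := by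
  classical
  set C : ℝ := ∫ u : Rn n, radialDensity u with hC
  have hC0 : C ≠ 0 := (integral_radialDensity_pos hn).ne'
  set F : Cn n → E := fun z => if h : ∃ χ, IsCutoff U z 1 χ then
    (-(C : ℂ)⁻¹) • kernelIntegral γ (cutoffDensity γ f h.choose) z else 0 with hF
  have hFeq : ∀ {z χ}, IsCutoff U z 1 χ →
      F z = (-(C : ℂ)⁻¹) • kernelIntegral γ (cutoffDensity γ f χ) z := fun {z χ} h => by
    have hex : ∃ χ, IsCutoff U z 1 χ := ⟨χ, h⟩
    simp only [hF, dif_pos hex]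
    rw [hex.choose_spec.kernelIntegral_congr hγ hn heven hU hf hD h]
  refine ⟨F, fun x hx => ?_, fun z hz => ?_⟩
  · obtain ⟨χ, h⟩ := exists_isCutoff hU (z := jmap n x) (by simpa [realNull_jmap] using hx)
    rw [hFeq h, h.kernelIntegral_jmap hγ hn heven hU hf hD hx, ← Complex.coe_smul, smul_neg,
      neg_smul, neg_neg, inv_smul_smul₀ (Complex.ofReal_ne_zero.2 hC0)]
  · obtain ⟨χ, h⟩ := exists_isCutoff hU hz
    have hfc : ContinuousOn f U := fun x hx => (hf x hx).continuousAt.continuousWithinAt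
    have hcont := continuous_cutoffDensity γ hU hfc h.contDiff h.tsupport_subset
    have hcs := hasCompactSupport_cutoffDensity γ (f := f) h.hasCompactSupport
    have hdisj := h.disjoint_tsupport_cutoffDensity γ (f := f)
    have hder := hasFDerivAt_kernelIntegral γ hcont hcs hdisj
    have hev : F =ᶠ[𝓝 z] fun w => (-(C : ℂ)⁻¹) • kernelIntegral γ (cutoffDensity γ f χ) w := by
      filter_upwards [h.eventually] with w hw using hFeq hw
    refine ⟨(hder.differentiableAt.const_smul _).congr_of_eventuallyEq hev, ?_⟩
    rw [hev.fderiv_eq, fderiv_fun_const_smul hder.differentiableAt]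
    simp_rw [_root_.smul_apply, map_smul]
    rw [← Finset.smul_sum, sum_clifford_fderiv_kernelIntegral γ hγ hn heven hcont hcs hdisj,
      smul_zero]

end Continuation

section Clifford

variable {n : ℕ}

lemma Qf_apply (w : Cn n) : Qf n w = -sC n w := by
  simp [Qf, sC, QuadraticMap.weightedSumSquares_apply, sq]

lemma ιC_mul_ιC_mul (w : Cn n) (a : Cl n) : ιC n w * (ιC n w * a) = -sC n w • a := by
  rw [← mul_assoc, ιC, CliffordAlgebra.ι_sq_scalar, Qf_apply, Algebra.smul_def]

lemma ιC_eC_mul_ιC_eC_of_ne {i k : Fin n} (h : i ≠ k) :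
    ιC n (eC n i) * ιC n (eC n k) = -(ιC n (eC n k) * ιC n (eC n i)) := by
  rw [eq_neg_iff_add_eq_zero, ιC, CliffordAlgebra.ι_mul_ι_add_swap, QuadraticMap.polar, Qf_apply,
    Qf_apply, Qf_apply, sC_eC, sC_eC]
  have : sC n (eC n i + eC n k) = 2 := by
    simp only [sC, eC, PiLp.add_apply, add_sq, Finset.sum_add_distrib]
    have h0 : ∀ j : Fin n, (EuclideanSpace.single i (1 : ℂ)) j *
        (EuclideanSpace.single k (1 : ℂ)) j = 0 := fun j => by
      rcases eq_or_ne j i with rfl | hj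
      · simp [h]
      · simp [hj]
    simp_rw [mul_assoc, h0]
    have h1 := sC_eC (n := n) i
    have h2 := sC_eC (n := n) k
    simp only [sC, eC] at h1 h2
    rw [h1, h2]
    norm_num
  rw [this]
  norm_num

lemma exists_fg_submodule_ιC_mul_mem (k : ℕ) :
    ∃ S : Submodule ℂ (Cl n), S.FG ∧ 1 ∈ S ∧
      ∀ i : Fin n, (i : ℕ) < k → ∀ a ∈ S, ιC n (eC n i) * a ∈ S := by
  induction k with
  | zero => exact ⟨ℂ ∙ 1, Submodule.fg_span_singleton 1, Submodule.mem_span_singleton_self 1,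
      fun i hi => absurd hi (Nat.not_lt_zero _)⟩
  | succ k ih =>
    obtain ⟨S, hfg, h1, hS⟩ := ih
    by_cases hk : k < n
    · set e := ιC n (eC n ⟨k, hk⟩) with he
      refine ⟨S ⊔ S.map (LinearMap.mulLeft ℂ e), hfg.sup (hfg.map _),
        Submodule.mem_sup_left h1, fun i hi a ha => ?_⟩
      obtain ⟨b, hb, c, hc, rfl⟩ := Submodule.mem_sup.1 ha
      obtain ⟨c, hc, rfl⟩ := hc
      rw [LinearMap.mulLeft_apply, mul_add]
      rcases (Nat.lt_succ_iff.1 hi).lt_or_eq with hi | hi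
      · have hne : i ≠ ⟨k, hk⟩ := fun h => hi.ne (congrArg Fin.val h)
        refine Submodule.add_mem_sup (hS i hi b hb) ⟨-(ιC n (eC n i) * c), ?_, ?_⟩
        · exact neg_mem (hS i hi c hc)
        · rw [LinearMap.mulLeft_apply, ← mul_assoc, he, ιC_eC_mul_ιC_eC_of_ne hne, mul_neg,
            neg_mul, mul_assoc]
      · obtain rfl : i = ⟨k, hk⟩ := Fin.ext hi
        rw [he, ιC_mul_ιC_mul, add_comm]
        exact Submodule.add_mem_sup (S.smul_mem _ hc) ⟨b, hb, rfl⟩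
    · exact ⟨S, hfg, h1, fun i _ => hS i (i.2.trans_le (not_lt.1 hk))⟩

instance finite_Cl : Module.Finite ℂ (Cl n) := by
  obtain ⟨S, hfg, h1, hS⟩ := exists_fg_submodule_ιC_mul_mem (n := n) n
  refine ⟨?_⟩
  convert hfg
  refine (Submodule.eq_top_iff'.2 fun a => ?_).symm
  induction a using CliffordAlgebra.left_induction with
  | algebraMap r => rw [Algebra.algebraMap_eq_smul_one]; exact S.smul_mem _ h1
  | add x y hx hy => exact S.add_mem hx hy
  | ι_mul x m hx =>
    change ιC n m * x ∈ S
    rw [← sum_smul_eC m, map_sum, Finset.sum_mul]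
    refine S.sum_mem fun i _ => ?_
    rw [map_smul, smul_mul_assoc]
    exact S.smul_mem _ (hS i i.2 x hx)

/-- Coordinates on the Clifford algebra. -/
def clCoord : Cl n ≃ₗ[ℂ] (Fin (Module.finrank ℂ (Cl n)) → ℂ) :=
  (Module.finBasis ℂ (Cl n)).equivFun

/-- Left Clifford multiplication by vectors, in coordinates. -/
def clMul : Cn n →L[ℂ] (Fin (Module.finrank ℂ (Cl n)) → ℂ) →L[ℂ]
    (Fin (Module.finrank ℂ (Cl n)) → ℂ) :=
  LinearMap.toContinuousLinearMap
    (LinearMap.toContinuousLinearMap.toLinearMap ∘ₗ clCoord.conj.toLinearMap ∘ₗ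
      LinearMap.mul ℂ (Cl n) ∘ₗ ιC n)

lemma clMul_apply (w : Cn n) (v : Fin (Module.finrank ℂ (Cl n)) → ℂ) :
    clMul w v = clCoord (ιC n w * clCoord.symm v) := rfl

lemma clMul_mul_clMul (w : Cn n) : clMul w * clMul w = -(sC n w) • 1 := by
  ext1 v
  simp [clMul_apply, ιC_mul_ιC_mul]

end Clifford

section Transfer

variable {n : ℕ}

/-- The coordinates of a differentiable Clifford-algebra-valued function are differentiable. -/
lemma HasPartialDerivsOn.exists_hasFDerivAt {f : Rn n → Cl n} {Df : Rn n → Fin n → Cl n}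
    {U : Set (Rn n)} (h : HasPartialDerivsOn n f Df U) {x : Rn n} (hx : x ∈ U) :
    HasFDerivAt (fun y => clCoord (f y)) (fderiv ℝ (fun y => clCoord (f y)) x) x ∧
      ∀ j, fderiv ℝ (fun y => clCoord (f y)) x (eR n j) = clCoord (Df x j) := by
  have hd : ∀ i, DifferentiableAt ℝ (fun y => clCoord (f y) i) x := fun i =>
    (h (LinearMap.proj i ∘ₗ clCoord.toLinearMap) x hx).1
  refine ⟨(differentiableAt_pi.2 hd).hasFDerivAt, fun j => funext fun i => ?_⟩
  rw [fderiv_pi hd]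
  exact (h (LinearMap.proj i ∘ₗ clCoord.toLinearMap) x hx).2 j

/-- A holomorphic function in coordinates is a holomorphic Clifford-algebra-valued function. -/
lemma hasFDerivAt_apply_clCoord_symm {F : Cn n → Fin (Module.finrank ℂ (Cl n)) → ℂ} {z : Cn n}
    (h : DifferentiableAt ℂ F z) (φ : Cl n →ₗ[ℂ] ℂ) :
    HasFDerivAt (fun w => φ (clCoord.symm (F w)))
      ((LinearMap.toContinuousLinearMap (φ ∘ₗ clCoord.symm.toLinearMap)).comp (fderiv ℂ F z)) z :=
  (LinearMap.toContinuousLinearMap (φ ∘ₗ clCoord.symm.toLinearMap)).hasFDerivAt.comp z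
    h.hasFDerivAt

/-- Holomorphic functions on a domain which agree at the real points near one point agree. -/
lemma IsHolomorphicOn.eqOn_of_eqOn_real {F G : Cn n → Cl n} {Ω : Set (Cn n)} {U : Set (Rn n)}
    (hΩ : IsOpen Ω) (hΩc : IsPreconnected Ω) (hF : IsHolomorphicOn n F Ω)
    (hG : IsHolomorphicOn n G Ω) (hU : IsOpen U) {x₀ : Rn n} (hx₀ : x₀ ∈ U)
    (hx₀Ω : jmap n x₀ ∈ Ω) (h : ∀ x ∈ U, F (jmap n x) = G (jmap n x)) : EqOn F G Ω := by
  intro z hz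
  refine clCoord.injective (funext fun i => sub_eq_zero.1 ?_)
  set φ : Cl n →ₗ[ℂ] ℂ := LinearMap.proj i ∘ₗ clCoord.toLinearMap
  have hg : DifferentiableOn ℂ (fun w => φ (F w) - φ (G w)) Ω := fun w hw =>
    ((hF φ w hw).sub (hG φ w hw)).differentiableWithinAt
  have h0 := eventuallyEq_zero_of_real hΩ hg hU hx₀ hx₀Ω fun x hx => by
    simp only [h x hx, sub_self]
  exact eqOn_zero_of_isPreconnected hΩ hΩc hg hx₀Ω h0 hz

end Transfer

end HolomorphicContinuation

/-- **holomorphic continuation to the cell of harmonicity.** For `n ≥ 2`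
even, `U ⊆ ℝⁿ` bounded open connected, and `f` left monogenic on `U`, there is a unique
holomorphic `F : U† → Cl_n(ℂ)` with `F ∘ j = f` on `U`; moreover `F` is complex left
monogenic on `U†`. -/
theorem holomorphic_continuation_to_cell_of_harmonicity (n : ℕ) (hn : 2 ≤ n)
    (heven : Even n) (U : Set (Rn n)) (hUo : IsOpen U)
    (hUb : Bornology.IsBounded U) (hUc : IsConnected U)
    (f : Rn n → Cl n) (hf : IsLeftMonogenicOn n f U)
    (x₀ : Rn n) (hx₀ : x₀ ∈ U) :
    ∃ F : Cn n → Cl n,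
      IsHolomorphicOn n F (cellOfHarmonicity n U x₀) ∧
      (∀ x ∈ U, F (jmap n x) = f x) ∧
      IsCLeftMonogenicOn n F (cellOfHarmonicity n U x₀) ∧
      ∀ F' : Cn n → Cl n, IsHolomorphicOn n F' (cellOfHarmonicity n U x₀) →
        (∀ x ∈ U, F' (jmap n x) = f x) →
        Set.EqOn F' F (cellOfHarmonicity n U x₀) := by
  obtain ⟨Df, hDf, hD⟩ := hf
  obtain ⟨F, hFU, hF⟩ := exists_complexMonogenic_extension clMul_mul_clMul hn heven hUo
    (fun x hx => (hDf.exists_hasFDerivAt hx).1) fun x hx => by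
      simp_rw [(hDf.exists_hasFDerivAt hx).2, clMul_apply, LinearEquiv.symm_apply_apply]
      rw [← map_sum, hD x hx, map_zero]
  replace hF := fun z (hz : z ∈ cellOfHarmonicity n U x₀) =>
    hF z (realNull_subset_of_mem_cellOfHarmonicity hn hUo hx₀ hz)
  have hhol : IsHolomorphicOn n (fun z => clCoord.symm (F z)) (cellOfHarmonicity n U x₀) :=
    fun φ z hz => (hasFDerivAt_apply_clCoord_symm (hF z hz).1 φ).differentiableAt
  have hreal : ∀ x ∈ U, clCoord.symm (F (jmap n x)) = f x := fun x hx => by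
    rw [hFU x hx, LinearEquiv.symm_apply_apply]
  refine ⟨_, hhol, hreal, ⟨fun z j => clCoord.symm (fderiv ℂ F z (eC n j)), fun φ z hz =>
    ⟨hhol φ z hz, fun j => ?_⟩, fun z hz => ?_⟩, fun F' hF' hF'U => ?_⟩
  · rw [(hasFDerivAt_apply_clCoord_symm (hF z hz).1 φ).fderiv]
    rfl
  · refine clCoord.injective ?_
    rw [map_sum, map_zero, ← (hF z hz).2]
    rfl
  · exact hF'.eqOn_of_eqOn_real (isOpen_cellOfHarmonicity hUb x₀)
      isPreconnected_connectedComponentIn hhol hUo hx₀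
      (jmap_mem_cellOfHarmonicity hUo hUc hx₀ hx₀) fun x hx => (hF'U x hx).trans (hreal x hx).symm
end
end

section
/- (Propagation of the complex Dirac equation from the real slice.) Let n ≥ 2, let Ω ⊆ ℂⁿ be open and connected, and let F : Ω → Cl_n(ℂ) be holomorphic. Let j : ℝⁿ → ℂⁿ be the componentwise embedding and suppose U = {x ∈ ℝⁿ : j(x) ∈ Ω} is nonempty. If the restriction x ↦ F(j(x)) is left monogenic on U, then F is complex left monogenic on all of Ω, i.e. Σ_{j=1}^n ι(e_j)·(∂F/∂z_j)(z) = 0 for every z ∈ Ω. -/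
noncomputable section
open MeasureTheory
open scoped BigOperators ENNReal

open Metric Set Filter Topology

/-- The exterior algebra of a finite module over a field is finite. -/
theorem ExteriorAlgebra.module_finite {K M : Type*} [Field K] [AddCommGroup M] [Module K M]
    [Module.Finite K M] : Module.Finite K (ExteriorAlgebra K M) := by
  have htop : (⨆ i : ℕ, ⋀[K]^i M) = ⊤ :=
    (DirectSum.Decomposition.isInternal (fun i : ℕ => ⋀[K]^i M)).submodule_iSup_eq_top
  have hle : (⊤ : Submodule K (ExteriorAlgebra K M)) ≤
      ⨆ i ∈ Finset.range (Module.finrank K M + 1), ⋀[K]^i M := by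
    rw [← htop]
    refine iSup_le fun i => ?_
    by_cases hi : i ∈ Finset.range (Module.finrank K M + 1)
    · exact le_iSup₂_of_le i hi le_rfl
    · have hr : Module.finrank K (⋀[K]^i M) = 0 := by
        rw [exteriorPower.finrank_eq]
        exact Nat.choose_eq_zero_of_lt (by simpa [Nat.lt_succ_iff] using hi)
      rw [Submodule.finrank_eq_zero.mp hr]
      exact bot_le
  refine ⟨?_⟩
  rw [← top_le_iff.mp hle]
  exact Submodule.fg_biSup _ _ fun i _ => Module.Finite.iff_fg.mp inferInstance

/-- The Clifford algebra of a quadratic form on a finite-dimensional complex space is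
finite-dimensional. -/
theorem CliffordAlgebra.module_finite {M : Type*} [AddCommGroup M] [Module ℂ M]
    [Module.Finite ℂ M] (Q : QuadraticForm ℂ M) : Module.Finite ℂ (CliffordAlgebra Q) :=
  have := ExteriorAlgebra.module_finite (K := ℂ) (M := M)
  Module.Finite.equiv (CliffordAlgebra.equivExterior Q).symm

/-- In a finite-dimensional space, a linear functional on the dual is evaluation at a vector. -/
theorem exists_forall_dual_eq {K V : Type*} [Field K] [AddCommGroup V] [Module K V]
    [Module.Finite K V] (L : (V →ₗ[K] K) →ₗ[K] K) : ∃ v : V, ∀ φ : V →ₗ[K] K, L φ = φ v :=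
  ⟨(Module.evalEquiv K V).symm L, fun φ => by simp⟩

/-- Quantitative first-order Taylor estimate for a bounded holomorphic function on a disc. -/
theorem norm_dslope_sub_deriv_le {f : ℂ → ℂ} {δ C : ℝ} (hδ : 0 < δ)
    (hd : DifferentiableOn ℂ f (ball 0 δ))
    (hm : MapsTo f (ball 0 δ) (closedBall (f 0) C)) {s : ℂ} (hs : s ∈ ball 0 δ) :
    ‖dslope f 0 s - deriv f 0‖ ≤ (2 * (C / δ)) / δ * ‖s‖ := by
  have hD : DifferentiableOn ℂ (dslope f 0) (ball 0 δ) :=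
    (Complex.differentiableOn_dslope (ball_mem_nhds _ hδ)).mpr hd
  have hb : ∀ z ∈ ball (0 : ℂ) δ, ‖dslope f 0 z‖ ≤ C / δ := fun z hz =>
    Complex.norm_dslope_le_div_of_mapsTo_ball hd hm hz
  have hm' : MapsTo (dslope f 0) (ball 0 δ) (closedBall (dslope f 0 0) (2 * (C / δ))) := by
    intro z hz
    rw [mem_closedBall, dist_eq_norm]
    linarith [norm_sub_le (dslope f 0 z) (dslope f 0 0), hb z hz, hb 0 (mem_ball_self hδ)]
  simpa [dist_eq_norm] using Complex.dist_le_div_mul_dist_of_mapsTo_ball hD hm' hs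

section Holomorphic

variable {E : Type*} [NormedAddCommGroup E] [NormedSpace ℂ E]

/-- A directional derivative of a holomorphic function is holomorphic along complex lines. -/
theorem differentiableAt_fderiv_apply_comp_line {h : E → ℂ} {Ω : Set E} (hΩ : IsOpen Ω)
    (hh : ∀ z ∈ Ω, DifferentiableAt ℂ h z) {e : E} (he : ‖e‖ ≤ 1) (p v : E) {t₀ : ℂ}
    (ht₀ : p + t₀ • v ∈ Ω) :
    DifferentiableAt ℂ (fun t : ℂ => fderiv ℂ h (p + t • v) e) t₀ := by
  set z₀ := p + t₀ • v
  obtain ⟨r, hr, hrΩ, hrh⟩ : ∃ r > 0, ball z₀ r ⊆ Ω ∧ ∀ z ∈ ball z₀ r, dist (h z) (h z₀) < 1 := by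
    have h1 : ∀ᶠ z in 𝓝 z₀, z ∈ Ω ∧ dist (h z) (h z₀) < 1 :=
      Filter.Eventually.and (hΩ.mem_nhds ht₀) ((hh z₀ ht₀).continuousAt.eventually (ball_mem_nhds _ one_pos))
    obtain ⟨r, hr, H⟩ := Metric.eventually_nhds_iff_ball.mp h1
    exact ⟨r, hr, fun z hz => (H z hz).1, fun z hz => (H z hz).2⟩
  set δ := r / 2 with hδdef
  have hδ : 0 < δ := half_pos hr
  have hline : Continuous fun t : ℂ => p + t • v := by fun_prop
  set S : Set ℂ := (fun t : ℂ => p + t • v) ⁻¹' ball z₀ δ with hSdef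
  have hSo : IsOpen S := isOpen_ball.preimage hline
  have hmem : ∀ t ∈ S, ∀ s ∈ ball (0 : ℂ) δ, p + t • v + s • e ∈ ball z₀ r := by
    intro t ht s hs
    have ht' : ‖p + t • v - z₀‖ < δ := by simpa [hSdef, dist_eq_norm] using ht
    have hs' : ‖s‖ < δ := by simpa using hs
    have hse : ‖s • e‖ ≤ ‖s‖ := by
      rw [norm_smul]; exact mul_le_of_le_one_right (norm_nonneg _) he
    rw [mem_ball, dist_eq_norm, add_sub_right_comm]
    linarith [norm_add_le (p + t • v - z₀) (s • e)]
  have hderiv : ∀ t ∈ S, deriv (fun s : ℂ => h (p + t • v + s • e)) 0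
      = fderiv ℂ h (p + t • v) e := by
    intro t ht
    have hz : p + t • v ∈ Ω := hrΩ (by simpa using hmem t ht 0 (mem_ball_self hδ))
    have h2 : HasDerivAt (fun s : ℂ => p + t • v + s • e) e 0 := by
      simpa using ((hasDerivAt_id (0 : ℂ)).smul_const e).const_add (p + t • v)
    have h1 : HasFDerivAt h (fderiv ℂ h (p + t • v)) (p + t • v + (0 : ℂ) • e) := by
      simpa using (hh _ hz).hasFDerivAt
    exact (h1.comp_hasDerivAt (0 : ℂ) h2).deriv
  have hest : ∀ t ∈ S, ∀ s ∈ ball (0 : ℂ) δ,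
      ‖dslope (fun s : ℂ => h (p + t • v + s • e)) 0 s - fderiv ℂ h (p + t • v) e‖
        ≤ (2 * (2 / δ)) / δ * ‖s‖ := by
    intro t ht s hs
    rw [← hderiv t ht]
    refine norm_dslope_sub_deriv_le hδ ?_ ?_ hs
    · intro s hs
      have h1 := hh _ (hrΩ (hmem t ht s hs))
      have h2 : DifferentiableAt ℂ (fun s : ℂ => p + t • v + s • e) s := by fun_prop
      exact (DifferentiableAt.comp s h1 h2).differentiableWithinAt
    · intro s hs
      have h1 := hrh _ (hmem t ht s hs)
      have h2 := hrh _ (hmem t ht 0 (mem_ball_self hδ))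
      rw [mem_closedBall]
      linarith [dist_triangle_right (h (p + t • v + s • e)) (h (p + t • v + (0 : ℂ) • e)) (h z₀)]
  have hlim : TendstoUniformlyOn
      (fun (s : ℂ) (t : ℂ) => dslope (fun s : ℂ => h (p + t • v + s • e)) 0 s)
      (fun t => fderiv ℂ h (p + t • v) e) (𝓝[≠] 0) S := by
    rw [Metric.tendstoUniformlyOn_iff]
    intro ε hε
    have h1 : Tendsto (fun s : ℂ => (2 * (2 / δ)) / δ * ‖s‖) (𝓝[≠] 0) (𝓝 0) := by
      have : Continuous fun s : ℂ => (2 * (2 / δ)) / δ * ‖s‖ := by fun_prop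
      simpa using (this.tendsto 0).mono_left nhdsWithin_le_nhds
    filter_upwards [h1.eventually (gt_mem_nhds hε),
      nhdsWithin_le_nhds (ball_mem_nhds (0 : ℂ) hδ)] with s hs hsδ t ht
    rw [dist_comm, dist_eq_norm]
    exact (hest t ht s hsδ).trans_lt hs
  have hdiff : DifferentiableOn ℂ (fun t => fderiv ℂ h (p + t • v) e) S := by
    refine hlim.tendstoLocallyUniformlyOn.differentiableOn ?_ hSo
    filter_upwards [self_mem_nhdsWithin, nhdsWithin_le_nhds (ball_mem_nhds (0 : ℂ) hδ)]
      with s hs hsδ t ht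
    have hd : ∀ s ∈ ball (0 : ℂ) δ, DifferentiableAt ℂ (fun t : ℂ => h (p + t • v + s • e)) t := by
      intro s hs
      have h1 := hh _ (hrΩ (hmem t ht s hs))
      have h2 : DifferentiableAt ℂ (fun t : ℂ => p + t • v + s • e) t := by fun_prop
      exact DifferentiableAt.comp t h1 h2
    simp only [dslope_of_ne _ (show s ≠ 0 from hs), slope_def_module]
    exact (((hd s hsδ).fun_sub (hd 0 (mem_ball_self hδ))).fun_const_smul _).differentiableWithinAt
  exact hdiff.differentiableAt (hSo.mem_nhds (mem_ball_self hδ))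

/-- The identity theorem on a convex open set, restricted to one complex line. -/
theorem eq_zero_of_frequently_zero_on_line {g : E → ℂ} {B : Set E} (hBo : IsOpen B)
    (hBc : Convex ℝ B)
    (hg : ∀ p v : E, ∀ t : ℂ, p + t • v ∈ B → DifferentiableAt ℂ (fun t : ℂ => g (p + t • v)) t)
    {p v : E} {t : ℂ} (hp : p ∈ B) (ht : p + t • v ∈ B)
    (hz : ∃ᶠ s in 𝓝[≠] (0 : ℂ), g (p + s • v) = 0) : g (p + t • v) = 0 := by
  have hline : Continuous fun t : ℂ => p + t • v := by fun_prop
  have hSo : IsOpen ((fun t : ℂ => p + t • v) ⁻¹' B) := hBo.preimage hline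
  have hSc : Convex ℝ ((fun t : ℂ => p + t • v) ⁻¹' B) := by
    intro x hx y hy a b ha hb hab
    have := hBc hx hy ha hb hab
    have e : a • (p + x • v) + b • (p + y • v) = p + (a • x + b • y) • v := by
      rw [add_smul, smul_assoc, smul_assoc, smul_add, smul_add, add_add_add_comm, ← add_smul, hab,
        one_smul]
    rwa [e] at this
  have han : AnalyticOnNhd ℂ (fun t : ℂ => g (p + t • v)) ((fun t : ℂ => p + t • v) ⁻¹' B) :=
    DifferentiableOn.analyticOnNhd (fun s hs => (hg p v s hs).differentiableWithinAt) hSo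
  exact han.eqOn_zero_of_preconnected_of_frequently_eq_zero hSc.isPreconnected
    (by simpa using hp) hz ht

/-- A function holomorphic along complex lines that vanishes near a point of a connected open set
vanishes on the whole set. -/
theorem eqOn_zero_of_differentiable_on_lines {g : E → ℂ} {Ω : Set E} (hΩ : IsOpen Ω)
    (hΩc : IsPreconnected Ω)
    (hg : ∀ p v : E, ∀ t : ℂ, p + t • v ∈ Ω → DifferentiableAt ℂ (fun t : ℂ => g (p + t • v)) t)
    {z₀ : E} (hz₀ : z₀ ∈ Ω) (h₀ : ∀ᶠ z in 𝓝 z₀, g z = 0) : ∀ z ∈ Ω, g z = 0 := by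
  have hsub : Ω ⊆ {z | ∀ᶠ w in 𝓝 z, g w = 0} := by
    refine hΩc.subset_of_closure_inter_subset isOpen_setOfPred_eventually_nhds ⟨z₀, hz₀, h₀⟩ ?_
    rintro z ⟨hzc, hzΩ⟩
    obtain ⟨r, hr, hrΩ⟩ := Metric.isOpen_iff.mp hΩ z hzΩ
    obtain ⟨w, hwr, hw⟩ := mem_closure_iff.mp hzc _ isOpen_ball (mem_ball_self hr)
    refine Filter.eventually_of_mem (ball_mem_nhds z hr) fun u hu => ?_
    have hline : Tendsto (fun s : ℂ => w + s • (u - w)) (𝓝[≠] 0) (𝓝 w) := by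
      have : Continuous fun s : ℂ => w + s • (u - w) := by fun_prop
      simpa using (this.tendsto 0).mono_left nhdsWithin_le_nhds
    have := eq_zero_of_frequently_zero_on_line isOpen_ball (convex_ball z r)
      (fun p v t ht => hg p v t (hrΩ ht)) (v := u - w) (t := 1) hwr (by simpa using hu)
      (hline.eventually hw).frequently
    simpa using this
  exact fun z hz => (hsub hz).self_of_nhds

end Holomorphic

/-- The embedding `jmap` as a continuous real-linear map. -/
def jmapCLM (n : ℕ) : Rn n →L[ℝ] Cn n :=
  LinearMap.toContinuousLinearMap
    { toFun := jmap n
      map_add' := fun x y => by ext i; simp [jmap]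
      map_smul' := fun c x => by ext i; simp [jmap] }

theorem jmapCLM_apply (n : ℕ) (x : Rn n) : jmapCLM n x = jmap n x := rfl

theorem jmapCLM_eR (n : ℕ) (j : Fin n) : jmapCLM n (eR n j) = eC n j := by
  ext i
  by_cases h : i = j <;> simp [jmapCLM_apply, jmap, eR, eC, h]

/-- A function on `ℂⁿ`, holomorphic along complex lines, that vanishes on the real slice of a
connected open set vanishes on the whole set. -/
theorem eqOn_zero_of_real_slice {n : ℕ} {g : Cn n → ℂ} {Ω : Set (Cn n)} (hΩ : IsOpen Ω)
    (hΩc : IsPreconnected Ω)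
    (hg : ∀ p v : Cn n, ∀ t : ℂ, p + t • v ∈ Ω →
      DifferentiableAt ℂ (fun t : ℂ => g (p + t • v)) t)
    {x₀ : Rn n} (hx₀ : jmap n x₀ ∈ Ω) (h₀ : ∀ x : Rn n, jmap n x ∈ Ω → g (jmap n x) = 0) :
    ∀ z ∈ Ω, g z = 0 := by
  refine eqOn_zero_of_differentiable_on_lines hΩ hΩc hg hx₀ ?_
  obtain ⟨r, hr, hrΩ⟩ := Metric.isOpen_iff.mp hΩ _ hx₀
  refine Filter.eventually_of_mem (ball_mem_nhds _ hr) fun z hz => ?_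
  set a : Rn n := WithLp.toLp 2 fun i => (z i).re with ha
  set b : Rn n := WithLp.toLp 2 fun i => (z i).im with hb
  have hzab : jmap n a + Complex.I • jmap n b = z := by
    ext i
    simp [jmap, ha, hb, mul_comm Complex.I, Complex.re_add_im]
  have hac : jmap n a ∈ ball (jmap n x₀) r := by
    refine lt_of_le_of_lt ?_ (mem_ball.mp hz)
    rw [EuclideanSpace.dist_eq, EuclideanSpace.dist_eq]
    refine Real.sqrt_le_sqrt (Finset.sum_le_sum fun i _ => ?_)
    gcongr
    rw [dist_eq_norm, dist_eq_norm]
    have : (jmap n a) i - (jmap n x₀) i = (((z i - jmap n x₀ i).re : ℝ) : ℂ) := by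
      simp [jmap, ha]
    rw [this, Complex.norm_real]
    exact Complex.abs_re_le_norm _
  have hreal : ∀ᶠ s : ℝ in 𝓝[≠] 0, g (jmap n a + (s : ℂ) • jmap n b) = 0 := by
    have hc : Continuous fun s : ℝ => jmap n a + (s : ℂ) • jmap n b := by fun_prop
    have : Tendsto (fun s : ℝ => jmap n a + (s : ℂ) • jmap n b) (𝓝[≠] 0) (𝓝 (jmap n a)) := by
      simpa using (hc.tendsto 0).mono_left nhdsWithin_le_nhds
    filter_upwards [this.eventually (isOpen_ball.mem_nhds hac)] with s hs
    have e : jmap n a + (s : ℂ) • jmap n b = jmap n (a + s • b) := by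
      ext i; simp [jmap]
    rw [e] at hs ⊢
    exact h₀ _ (hrΩ hs)
  have hofReal : Tendsto (fun s : ℝ => (s : ℂ)) (𝓝[≠] 0) (𝓝[≠] 0) := by
    refine tendsto_nhdsWithin_iff.mpr ⟨?_, ?_⟩
    · simpa using (Complex.continuous_ofReal.tendsto 0).mono_left nhdsWithin_le_nhds
    · filter_upwards [self_mem_nhdsWithin] with s hs
      simpa using hs
  have := eq_zero_of_frequently_zero_on_line isOpen_ball (convex_ball _ r)
    (fun p v t ht => hg p v t (hrΩ ht)) hac (by rwa [hzab])
    (hofReal.frequently hreal.frequently)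
  rwa [hzab] at this

/-- A holomorphic Clifford-valued function has partial derivatives in the Clifford algebra. -/
theorem IsHolomorphicOn.exists_hasCPartialDerivsOn {n : ℕ} {F : Cn n → Cl n} {Ω : Set (Cn n)}
    (hF : IsHolomorphicOn n F Ω) : ∃ DF, HasCPartialDerivsOn n F DF Ω := by
  have : Module.Finite ℂ (Cl n) := CliffordAlgebra.module_finite (Qf n)
  have key : ∀ z : Cn n, ∀ j : Fin n, ∃ d : Cl n, z ∈ Ω →
      ∀ φ : Cl n →ₗ[ℂ] ℂ, fderiv ℂ (fun w => φ (F w)) z (eC n j) = φ d := by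
    intro z j
    by_cases hz : z ∈ Ω
    · obtain ⟨d, hd⟩ := exists_forall_dual_eq (K := ℂ) (V := Cl n)
        { toFun := fun φ => fderiv ℂ (fun w => φ (F w)) z (eC n j)
          map_add' := fun φ ψ => by
            simp only [LinearMap.add_apply]
            rw [fderiv_fun_add (hF φ z hz) (hF ψ z hz)]
            rfl
          map_smul' := fun c φ => by
            simp only [LinearMap.smul_apply]
            rw [fderiv_fun_const_smul (hF φ z hz)]
            rfl }
      exact ⟨d, fun _ => hd⟩
    · exact ⟨0, fun h => absurd h hz⟩
  choose DF hDF using key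
  exact ⟨DF, fun φ z hz => ⟨hF φ z hz, fun j => hDF z j hz φ⟩⟩

/-- **propagation of the complex Dirac equation from the real slice.**
Let `Ω ⊆ ℂⁿ` be open and connected, `F : Ω → Cl_n(ℂ)` holomorphic, and suppose
`U = j⁻¹(Ω) ⊆ ℝⁿ` is nonempty. If `x ↦ F(j(x))` is left monogenic on `U`, then `F` is
complex left monogenic on all of `Ω`. -/
theorem complex_left_monogenic_of_real_slice (n : ℕ) (hn : 2 ≤ n)
    (Ω : Set (Cn n)) (hΩo : IsOpen Ω) (hΩc : IsConnected Ω)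
    (F : Cn n → Cl n) (hF : IsHolomorphicOn n F Ω)
    (hne : {x : Rn n | jmap n x ∈ Ω}.Nonempty)
    (hmono : IsLeftMonogenicOn n (fun x => F (jmap n x)) {x : Rn n | jmap n x ∈ Ω}) :
    IsCLeftMonogenicOn n F Ω := by
  obtain ⟨DF, hDF⟩ := hF.exists_hasCPartialDerivsOn
  obtain ⟨Df, hDf, hDf0⟩ := hmono
  obtain ⟨x₀, hx₀⟩ := hne
  refine ⟨DF, hDF, fun z hz => ?_⟩
  rw [← Module.forall_dual_apply_eq_zero_iff ℂ]
  intro φ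
  let ψ : Fin n → Cl n →ₗ[ℂ] ℂ := fun j => φ ∘ₗ LinearMap.mulLeft ℂ (ιC n (eC n j))
  let g : Cn n → ℂ := fun w => ∑ j, fderiv ℂ (fun w => ψ j (F w)) w (eC n j)
  have hgz : φ (∑ j, ιC n (eC n j) * DF z j) = g z := by
    rw [map_sum]
    exact Finset.sum_congr rfl fun j _ => ((hDF (ψ j) z hz).2 j).symm
  rw [hgz]
  refine eqOn_zero_of_real_slice hΩo hΩc.isPreconnected ?_ hx₀ ?_ z hz
  · intro p v t ht
    exact DifferentiableAt.fun_sum fun j _ =>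
      differentiableAt_fderiv_apply_comp_line hΩo (hF (ψ j)) (by simp [eC]) p v ht
  · intro x hx
    have h1 : ∀ j, fderiv ℂ (fun w => ψ j (F w)) (jmap n x) (eC n j) = ψ j (Df x j) := by
      intro j
      rw [← (hDf (ψ j) x hx).2 j]
      have hc := HasFDerivAt.comp x
        (f := jmapCLM n) (g := fun w => ψ j (F w))
        ((hF (ψ j) (jmap n x) hx).hasFDerivAt.restrictScalars ℝ) (jmapCLM n).hasFDerivAt
      have hc' : fderiv ℝ (fun y => ψ j (F (jmap n y))) x = _ := hc.fderiv
      rw [hc', ContinuousLinearMap.comp_apply, jmapCLM_eR]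
      rfl
    have h2 := congrArg φ (hDf0 x hx)
    rw [map_sum, map_zero] at h2
    exact (Finset.sum_congr rfl fun j _ => h1 j).trans h2
end
end
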